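/- arXiv:1402.4184 — 2 statements merged into one kernel-verified Lean document; each statement's English description precedes it below -/
import Mathlib

section
/- Let G be a countably infinite discrete group and let G ↷ X be a free Borel action of G on a standard Borel space X. Then there exists a G-equivariant Borel map f : X → 2^G such that the closure of f(X) in 2^G is contained in Free(2^G). -/
open MeasureTheory Set

/-- The left shift action of `G` on the 2-shift `2^G = G → Bool`:
`(g • w)(h) = w (g⁻¹ * h)`. -/
def shift {G : Type*} [Group G] (g : G) (w : G → Bool) : G → Bool :=
  fun h => w (g⁻¹ * h)

/-- The free part of the 2-shift: points with trivial stabilizer. -/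
def FreePart (G : Type*) [Group G] : Set (G → Bool) :=
  {w | ∀ g : G, g ≠ 1 → shift g w ≠ w}

open scoped Pointwise Classical

section Combinatorics

theorem exists_seq_notMem {α : Type*} [Infinite α] (F : Finset α → Finset α) :
    ∃ (b : ℕ → α) (s : ℕ → Finset α), (∀ a n, a < n → b a ∈ s n) ∧ ∀ n, b n ∉ F (s n) := by
  choose pick hpick using fun t : Finset α => Infinite.exists_notMem_finset t
  let s : ℕ → Finset α := fun n => Nat.rec ∅ (fun _ t => insert (pick (F t)) t) n
  refine ⟨fun n => pick (F (s n)), s, fun a n han => ?_, fun n => hpick _⟩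
  induction n, han using Nat.le_induction with
  | base => exact Finset.mem_insert_self _ _
  | succ n _ ih => exact Finset.mem_insert_of_mem ih

/-- A family of group elements is dispersed with respect to `W` if distinct members are not
`W`-close, and a right translation moves at most two members `W`-close to a different member. -/
structure Dispersed {G : Type*} [Group G] (W : Finset G) {ι : Type*} (b : ι → G) : Prop where
  spread : ∀ i j, i ≠ j → b i * (b j)⁻¹ ∉ W
  moved : ∀ u i j k i' j' k', i ≠ j → i ≠ k → j ≠ k → i ≠ i' → j ≠ j' → k ≠ k' →
    b i * u * (b i')⁻¹ ∈ W → b j * u * (b j')⁻¹ ∈ W → b k * u * (b k')⁻¹ ∈ W → False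

variable {G : Type*} [Group G]

theorem Dispersed.comp {W : Finset G} {ι κ : Type*} {b : ι → G} (hb : Dispersed W b) {f : κ → ι}
    (hf : Function.Injective f) : Dispersed W (b ∘ f) where
  spread i j hij := hb.spread _ _ (hf.ne hij)
  moved u i j k i' j' k' h₁ h₂ h₃ h₄ h₅ h₆ := hb.moved u (f i) (f j) (f k) (f i') (f j') (f k')
    (hf.ne h₁) (hf.ne h₂) (hf.ne h₃) (hf.ne h₄) (hf.ne h₅) (hf.ne h₆)

theorem exists_dispersed [Infinite G] (W : Finset G) : ∃ b : ℕ → G, Dispersed W b := by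
  set V₀ : Finset G := insert 1 (W ∪ W⁻¹)
  set V : Finset G := V₀ * V₀
  have h1 : (1 : G) ∈ V₀ := Finset.mem_insert_self _ _
  have hW : ∀ w ∈ W, w ∈ V₀ := fun w hw => by simp [V₀, hw]
  have hW' : ∀ w ∈ W, w⁻¹ ∈ V₀ := fun w hw => by simp [V₀, hw]
  have hV₀ : ∀ w ∈ V₀, w ∈ V := fun w hw => by
    simpa using Finset.mul_mem_mul hw h1
  obtain ⟨b, s, hs, hb⟩ := exists_seq_notMem fun t : Finset G => V * t * t⁻¹ * V * t
  have key : ∀ n a e e', a < n → e < n → e' < n → ∀ v ∈ V, ∀ v' ∈ V,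
      b n ≠ v * b a * (b e)⁻¹ * v' * b e' := by
    intro n a e e' ha he he' v hv v' hv' h
    apply hb n
    rw [h]
    exact Finset.mul_mem_mul (Finset.mul_mem_mul (Finset.mul_mem_mul (Finset.mul_mem_mul hv
      (hs _ _ ha)) (Finset.inv_mem_inv (hs _ _ he))) hv') (hs _ _ he')
  have sp : ∀ i j, j < i → ∀ v ∈ V, b i ≠ v * b j := by
    intro i j hij v hv h
    refine key i j j j hij hij hij v hv 1 (hV₀ _ h1) ?_
    rw [h]; group
  have two : ∀ u a a' e e', a ≠ a' → e ≠ e' → b a * u * (b a')⁻¹ ∈ W → b e * u * (b e')⁻¹ ∈ W →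
      max a a' ≤ max e e' := by
    intro u a a' e e' haa hee h₁ h₂
    by_contra hlt
    rcases lt_or_gt_of_ne haa with h | h
    · refine key a' a e e' h (by omega) (by omega) _ (hV₀ _ (hW' _ h₁)) _ (hV₀ _ (hW _ h₂)) ?_
      group
    · refine key a a' e' e h (by omega) (by omega) _ (hV₀ _ (hW _ h₁)) _ (hV₀ _ (hW' _ h₂)) ?_
      group
  have inj : ∀ u i j i' j', i ≠ j → b i * u * (b i')⁻¹ ∈ W → b j * u * (b j')⁻¹ ∈ W →
      i' ≠ j' := by
    rintro u i j i' j' hij h₁ h₂ rfl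
    rcases lt_or_gt_of_ne hij with h | h
    · refine sp j i h _ (Finset.mul_mem_mul (hW _ h₂) (hW' _ h₁)) ?_
      group
    · refine sp i j h _ (Finset.mul_mem_mul (hW _ h₁) (hW' _ h₂)) ?_
      group
  refine ⟨b, fun i j hij hW₁ => ?_, ?_⟩
  · rcases lt_or_gt_of_ne hij with h | h
    · refine sp j i h _ (hV₀ _ (hW' _ hW₁)) ?_
      group
    · refine sp i j h _ (hV₀ _ (hW _ hW₁)) ?_
      group
  · intro u i j k i' j' k' h₁ h₂ h₃ h₄ h₅ h₆ hi hj hk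
    have := two _ _ _ _ _ h₄ h₅ hi hj
    have := two _ _ _ _ _ h₅ h₄ hj hi
    have := two _ _ _ _ _ h₄ h₆ hi hk
    have := two _ _ _ _ _ h₆ h₄ hk hi
    have := inj _ _ _ _ _ h₁ hi hj
    have := inj _ _ _ _ _ h₂ hi hk
    have := inj _ _ _ _ _ h₃ hj hk
    omega

end Combinatorics

section Greedy

variable {G : Type*} [Group G] {X : Type*} [MeasurableSpace X] [MulAction G X]

/-- Any free Borel action admits a countable Borel colouring separating `x` from `h • x` for `h`
in a given finite set. -/
theorem exists_nat_coloring [StandardBorelSpace X]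
    (hBorel : ∀ g : G, Measurable fun x : X => g • x)
    (hfree : ∀ (g : G) (x : X), g • x = x → g = 1) (H : Finset G) (hH : 1 ∉ H) :
    ∃ ν : X → ℕ, Measurable ν ∧ ∀ x, ∀ h ∈ H, ν (h • x) ≠ ν x := by
  let _ : MeasurableSpace (List Bool) := ⊤
  obtain ⟨φ, hφ, hinj⟩ := MeasurableSpace.measurable_injection_nat_bool_of_countablySeparated X
  let pre : ℕ → X → List Bool := fun n x => List.ofFn fun i : Fin n => φ x i
  have hpre : ∀ n, Measurable (pre n) := fun n =>
    (Measurable.of_discrete (f := fun w : Fin n → Bool => List.ofFn w)).comp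
      (measurable_pi_lambda _ fun i => (measurable_pi_apply _).comp hφ)
  have hex : ∀ x, ∃ n, ∀ h ∈ H, pre n (h • x) ≠ pre n x := by
    intro x
    have h₁ : ∀ h ∈ H, ∃ i, φ (h • x) i ≠ φ x i := by
      intro h hh
      by_contra hcon
      push Not at hcon
      exact hH (hfree h x (hinj (funext hcon)) ▸ hh)
    choose! i hi using h₁
    refine ⟨H.sup i + 1, fun h hh heq => hi h hh ?_⟩
    have := congrFun (List.ofFn_injective heq) ⟨i h, Nat.lt_succ_of_le (Finset.le_sup hh)⟩
    exact this
  have hlen : Measurable fun x => Nat.find (hex x) := by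
    refine measurable_find hex fun n => ?_
    have : {x | ∀ h ∈ H, pre n (h • x) ≠ pre n x} =
        ⋂ h ∈ H, {x | pre n (h • x) = pre n x}ᶜ := by ext; simp
    rw [this]
    exact H.measurableSet_biInter fun h _ =>
      (measurableSet_eq_fun ((hpre n).comp (hBorel h)) (hpre n)).compl
  refine ⟨fun x => Encodable.encode (pre (Nat.find (hex x)) x), ?_, fun x h hh heq => ?_⟩
  · have : Measurable fun q : ℕ × X => pre q.1 q.2 := measurable_from_prod_countable_right hpre
    exact (Measurable.of_discrete (f := fun l : List Bool => Encodable.encode l)).comp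
      (this.comp (hlen.prodMk measurable_id))
  · have h₂ := Encodable.encode_injective heq
    have h₃ := congrArg List.length h₂
    simp only [pre, List.length_ofFn] at h₃
    rw [h₃] at h₂
    exact Nat.find_spec (hex x) h hh h₂

/-- Recursion along a countable Borel colouring is Borel. -/
theorem exists_measurable_greedy (hBorel : ∀ g : G, Measurable fun x : X => g • x)
    {ν : X → ℕ} (hν : Measurable ν) (H : Finset G) {C : Type*} [Nonempty C] [Finite C]
    [MeasurableSpace C] [MeasurableSingletonClass C] (Ψ : (H → Option C) → C) :
    ∃ κ : X → C, Measurable κ ∧ ∀ x, κ x =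
      Ψ fun h => if ν ((h : G) • x) < ν x then some (κ ((h : G) • x)) else none := by
  let _ : MeasurableSpace (Option C) := ⊤
  let K : ℕ → X → C := fun n => Nat.rec (fun _ => Classical.arbitrary C) (fun n κ x =>
    if ν x = n then Ψ fun h => if ν ((h : G) • x) < n then some (κ ((h : G) • x)) else none
    else κ x) n
  have hsucc : ∀ n x, K (n + 1) x =
      if ν x = n then Ψ fun h => if ν ((h : G) • x) < n then some (K n ((h : G) • x)) else none
      else K n x := fun _ _ => rfl
  have hK : ∀ n, Measurable (K n) := by
    intro n
    induction n with
    | zero => exact measurable_const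
    | succ n ih =>
      refine Measurable.ite (measurableSet_eq_fun hν measurable_const) ?_ ih
      refine (Measurable.of_discrete (f := Ψ)).comp (measurable_pi_lambda _ fun h => ?_)
      exact Measurable.ite (measurableSet_lt (hν.comp (hBorel _)) measurable_const)
        ((Measurable.of_discrete (f := fun c : C => some c)).comp (ih.comp (hBorel _)))
        measurable_const
  have hstab : ∀ n x, ν x < n → K n x = K (ν x + 1) x := by
    intro n x hn
    induction n, hn using Nat.le_induction with
    | base => rfl
    | succ n hn ih => rw [hsucc, if_neg (by omega), ih]
  refine ⟨fun x => K (ν x + 1) x, ?_, fun x => ?_⟩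
  · have : Measurable fun q : ℕ × X => K (q.1 + 1) q.2 :=
      measurable_from_prod_countable_right fun n => hK (n + 1)
    exact this.comp (hν.prodMk measurable_id)
  · simp only
    rw [hsucc, if_pos rfl]
    congr 1
    funext h
    split_ifs with hlt
    · rw [hstab _ _ hlt]
    · rfl

theorem exists_measurable_avoiding (hBorel : ∀ g : G, Measurable fun x : X => g • x)
    (H : Finset G) {τ C : Type*} [Fintype τ] [Fintype C] [MeasurableSpace C]
    [MeasurableSingletonClass C] (hC : H.card * Fintype.card τ < Fintype.card C)
    {m : X → τ → C} (hm : Measurable m) :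
    ∃ f : X → C, Measurable f ∧ ∀ x, ∀ h ∈ H, ∀ i, f x ≠ m (h • x) i := by
  have hΨ : ∀ a : H → τ → C, ∃ c : C, ∀ h i, c ≠ a h i := by
    intro a
    by_contra hcon
    push Not at hcon
    choose f₁ f₂ hf using hcon
    have : Function.Injective fun c => (f₁ c, f₂ c) := fun c d hcd => by
      simp only [Prod.mk.injEq] at hcd
      rw [hf c, hf d, hcd.1, hcd.2]
    have := Fintype.card_le_of_injective _ this
    simp at this
    omega
  choose Ψ hΨ using hΨ
  refine ⟨fun x => Ψ fun h => m ((h : G) • x), ?_, fun x h hh i => hΨ _ ⟨h, hh⟩ i⟩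
  exact (Measurable.of_discrete (f := Ψ)).comp
    (measurable_pi_lambda _ fun h => hm.comp (hBorel _))

variable [StandardBorelSpace X]

theorem exists_measurable_coloring (hBorel : ∀ g : G, Measurable fun x : X => g • x)
    (hfree : ∀ (g : G) (x : X), g • x = x → g = 1) (H : Finset G) (hH : 1 ∉ H) {C : Type*}
    [Fintype C] [MeasurableSpace C] [MeasurableSingletonClass C]
    (hC : (H ∪ H⁻¹).card < Fintype.card C) :
    ∃ κ : X → C, Measurable κ ∧ ∀ x, ∀ h ∈ H, κ (h • x) ≠ κ x := by
  have : Nonempty C := Fintype.card_pos_iff.mp (by omega)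
  set S := H ∪ H⁻¹ with hS
  have hS1 : 1 ∉ S := by simp [hS, hH]
  obtain ⟨ν, hν, hνS⟩ := exists_nat_coloring hBorel hfree S hS1
  have hΨ : ∀ a : S → Option C, ∃ c : C, ∀ h, a h ≠ some c := by
    intro a
    by_contra hcon
    push Not at hcon
    choose f hf using hcon
    have : Function.Injective f := fun c d hcd => by
      have := (hf c).symm.trans (hcd ▸ hf d)
      exact Option.some_injective _ this
    have := Fintype.card_le_of_injective f this
    simp at this
    omega
  choose Ψ hΨ using hΨ
  obtain ⟨κ, hκ, hκS⟩ := exists_measurable_greedy hBorel hν S Ψ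
  have key : ∀ x, ∀ h ∈ S, ν (h • x) < ν x → κ (h • x) ≠ κ x := by
    intro x h hh hlt heq
    have := hΨ (fun h => if ν ((h : G) • x) < ν x then some (κ ((h : G) • x)) else none) ⟨h, hh⟩
    rw [← hκS x] at this
    simp [hlt, heq] at this
  refine ⟨κ, hκ, fun x h hh heq => ?_⟩
  have hhS : h ∈ S := Finset.mem_union_left _ hh
  have hhS' : h⁻¹ ∈ S := Finset.mem_union_right _ (Finset.inv_mem_inv hh)
  rcases lt_or_gt_of_ne (hνS x h hhS) with h₁ | h₁
  · exact key x h hhS h₁ heq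
  · have := key (h • x) h⁻¹ hhS' (by simpa using h₁)
    simp [heq] at this

/-- Borel maximal discrete sets exist. -/
theorem exists_measurable_marker (hBorel : ∀ g : G, Measurable fun x : X => g • x)
    (hfree : ∀ (g : G) (x : X), g • x = x → g = 1) (R : Finset G) :
    ∃ Y : Set X, MeasurableSet Y ∧ (∀ y ∈ Y, ∀ r ∈ R, r • y ∈ Y → r = 1) ∧
      ∀ x, ∃ r ∈ insert 1 (R ∪ R⁻¹), r • x ∈ Y := by
  set S := (R ∪ R⁻¹).erase 1 with hS
  obtain ⟨ν, hν, hνS⟩ := exists_nat_coloring hBorel hfree S (by simp [hS])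
  obtain ⟨κ, hκ, hκS⟩ := exists_measurable_greedy hBorel hν S
    fun a : S → Option Bool => decide (∀ h, a h ≠ some true)
  have key : ∀ x, κ x = true ↔ ∀ h ∈ S, ν (h • x) < ν x → κ (h • x) ≠ true := by
    intro x
    rw [hκS x]
    simp
  have hdisc : ∀ x, ∀ h ∈ S, ν (h • x) < ν x → κ x = true → κ (h • x) = true → False :=
    fun x h hh hlt h₁ h₂ => (key x).1 h₁ h hh hlt h₂
  refine ⟨{x | κ x = true}, hκ (measurableSet_singleton true), ?_, ?_⟩
  · intro y hy r hr hry
    by_contra hr1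
    have hrS : r ∈ S := by simp [hS, hr, hr1]
    have hrS' : r⁻¹ ∈ S := by simp [hS, hr, hr1]
    rcases lt_or_gt_of_ne (hνS y r hrS) with h₁ | h₁
    · exact hdisc y r hrS h₁ hy hry
    · exact hdisc (r • y) r⁻¹ hrS' (by simpa using h₁) hry (by simpa using hy)
  · intro x
    by_cases hx : κ x = true
    · exact ⟨1, Finset.mem_insert_self _ _, by simpa using hx⟩
    · rw [key] at hx
      push Not at hx
      obtain ⟨h, hh, -, h₂⟩ := hx
      exact ⟨h, Finset.mem_insert_of_mem (Finset.mem_of_mem_erase hh), h₂⟩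

end Greedy

section Windows

variable {G : Type*} [Group G]

theorem card_filter_mul_image_le (P : Finset G) {N : ℕ} (k : Fin N → G) (φ : G → Prop)
    [DecidablePred φ] :
    ((P * Finset.univ.image k).filter φ).card ≤ ∑ j, (P.filter fun p => φ (p * k j)).card := by
  rw [← Finset.card_sigma]
  refine Finset.card_le_card_of_surjOn (fun q : (_ : Fin N) × G => q.2 * k q.1) ?_
  intro x hx
  simp only [Finset.coe_filter, Finset.mem_mul, Finset.mem_image, Finset.mem_univ, true_and,
    Set.mem_ofPred_eq] at hx
  obtain ⟨⟨p, hp, _, ⟨j, rfl⟩, rfl⟩, hφ⟩ := hx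
  exact ⟨⟨j, p⟩, by simp [hp, hφ], rfl⟩

theorem mul_dispersed_inj {P W : Finset G} (hW : P⁻¹ * P ⊆ W) {ι : Type*} {k : ι → G}
    (hk : Dispersed W k) {p p' : G} (hp : p ∈ P) (hp' : p' ∈ P) {j j' : ι}
    (h : p * k j = p' * k j') : j = j' := by
  by_contra hne
  refine hk.spread j j' hne (hW ?_)
  have : k j * (k j')⁻¹ = p⁻¹ * p' := by
    rw [mul_inv_eq_iff_eq_mul, mul_assoc, ← h]; group
  rw [this]
  exact Finset.mul_mem_mul (Finset.inv_mem_inv hp) hp'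

theorem card_mul_dispersed {P W : Finset G} (hW : P⁻¹ * P ⊆ W) {N : ℕ} {k : Fin N → G}
    (hk : Dispersed W k) : (P * Finset.univ.image k).card = P.card * N := by
  have : P * Finset.univ.image k =
      (P ×ˢ (Finset.univ : Finset (Fin N))).image fun q => q.1 * k q.2 := by
    ext x; simp [Finset.mem_mul]
  rw [this, Finset.card_image_of_injOn, Finset.card_product, Finset.card_univ, Fintype.card_fin]
  rintro ⟨p, j⟩ hp ⟨p', j'⟩ hp' h
  simp only [Finset.coe_product, Set.mem_prod, Finset.mem_coe] at hp hp' h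
  obtain rfl := mul_dispersed_inj hW hk hp.1 hp'.1 h
  simpa using h

/-- At most two members of a dispersed family move to a different member modulo `P`. -/
theorem card_moved_le {P W : Finset G} (hW : P⁻¹ * P ⊆ W) {ι : Type*} {k : ι → G}
    (hk : Dispersed W k) (t : G) (S : Finset ι)
    (hS : ∀ j ∈ S, ∃ p ∈ P, ∃ p' ∈ P, ∃ j', j ≠ j' ∧ p * k j * t = p' * k j') : S.card ≤ 2 := by
  by_contra hcard
  obtain ⟨a, b, c, ha, hb, hc, hab, hac, hbc⟩ := Finset.two_lt_card_iff.1 (not_le.1 hcard)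
  have aux : ∀ j ∈ S, ∃ j', j ≠ j' ∧ k j * t * (k j')⁻¹ ∈ W := by
    intro j hj
    obtain ⟨p, hp, p', hp', j', hne, h⟩ := hS j hj
    refine ⟨j', hne, hW ?_⟩
    have : k j * t * (k j')⁻¹ = p⁻¹ * p' := by
      rw [mul_inv_eq_iff_eq_mul, mul_assoc p⁻¹, ← h]; group
    rw [this]
    exact Finset.mul_mem_mul (Finset.inv_mem_inv hp) hp'
  obtain ⟨a', ha₁, ha₂⟩ := aux a ha
  obtain ⟨b', hb₁, hb₂⟩ := aux b hb
  obtain ⟨c', hc₁, hc₂⟩ := aux c hc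
  exact hk.moved t a b c a' b' c' hab hac hbc ha₁ hb₁ hc₁ ha₂ hb₂ hc₂

theorem overlap_mul {P W : Finset G} (hP : P.Nonempty)
    (hov : ∀ t, t ≠ 1 → 2 * (P.filter fun p => p * t ∈ P).card < P.card)
    (hW : P⁻¹ * P ⊆ W) {N : ℕ} (hN : 8 * P.card < N) {k : Fin N → G} (hk : Dispersed W k)
    {t : G} (ht : t ≠ 1) :
    2 * ((P * Finset.univ.image k).filter fun x => x * t ∈ P * Finset.univ.image k).card <
      (P * Finset.univ.image k).card := by
  set Q := P * Finset.univ.image k with hQ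
  have hP0 := hP.card_pos
  set S : Finset (Fin N) := Finset.univ.filter fun j =>
    ∃ p ∈ P, ∃ p' ∈ P, ∃ j', j ≠ j' ∧ p * k j * t = p' * k j' with hS
  have hS2 : S.card ≤ 2 := card_moved_le hW hk t S fun j hj => (Finset.mem_filter.1 hj).2
  have hle := card_filter_mul_image_le P k fun x => x * t ∈ Q
  have hterm : ∀ j : Fin N, 2 * (P.filter fun p => p * k j * t ∈ Q).card ≤
      (P.card - 1) + if j ∈ S then P.card + 1 else 0 := by
    intro j
    split_ifs with hj
    · have := Finset.card_filter_le P fun p => p * k j * t ∈ Q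
      omega
    · have hsub : (P.filter fun p => p * k j * t ∈ Q) ⊆
          P.filter fun p => p * (k j * t * (k j)⁻¹) ∈ P := by
        intro p hp
        simp only [Finset.mem_filter, hQ, Finset.mem_mul, Finset.mem_image, Finset.mem_univ,
          true_and] at hp ⊢
        obtain ⟨hp, p', hp', _, ⟨j', rfl⟩, h⟩ := hp
        have hjj : j = j' := by
          by_contra hne
          exact hj (Finset.mem_filter.2 ⟨Finset.mem_univ _, p, hp, p', hp', j', hne, h.symm⟩)
        subst hjj
        refine ⟨hp, ?_⟩
        have : p * (k j * t * (k j)⁻¹) = p' := by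
          rw [← mul_assoc, ← mul_assoc, ← h]; group
        rwa [this]
      have h₁ := Finset.card_le_card hsub
      have h₂ := hov (k j * t * (k j)⁻¹) (by simpa [mul_inv_eq_one] using ht)
      omega
  have hsum : 2 * (Q.filter fun x => x * t ∈ Q).card ≤
      N * (P.card - 1) + 2 * (P.card + 1) := by
    calc 2 * (Q.filter fun x => x * t ∈ Q).card
        ≤ 2 * ∑ j, (P.filter fun p => p * k j * t ∈ Q).card :=
        Nat.mul_le_mul_left _ hle
      _ = ∑ j, 2 * (P.filter fun p => p * k j * t ∈ Q).card := Finset.mul_sum ..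
      _ ≤ ∑ j : Fin N, ((P.card - 1) + if j ∈ S then P.card + 1 else 0) :=
        Finset.sum_le_sum fun j _ => hterm j
      _ = N * (P.card - 1) + S.card * (P.card + 1) := by
        rw [Finset.sum_add_distrib]; simp
      _ ≤ _ := by gcongr
  rw [card_mul_dispersed hW hk]
  obtain ⟨n, hn⟩ : ∃ n, P.card = n + 1 := ⟨P.card - 1, by omega⟩
  rw [hn] at hsum hN ⊢
  simp only [Nat.add_sub_cancel] at hsum
  nlinarith

theorem density_mul {X : Type*} [MulAction G X] {P W : Finset G} (hP : P.Nonempty) {A A₂ : Set X}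
    (hA : ∀ w : X, 8 * (P.filter fun p => p • w ∈ A).card < P.card)
    (hW : P⁻¹ * P ⊆ W) {N : ℕ} (hN : 8 * P.card < N) {k : Fin N → G} (hk : Dispersed W k)
    (hA₂ : ∀ p ∈ P, ∀ w : X, (Finset.univ.filter fun j => (p * k j) • w ∈ A₂).card ≤ 1) (w : X) :
    8 * ((P * Finset.univ.image k).filter fun x => x • w ∈ A ∪ A₂).card <
      (P * Finset.univ.image k).card := by
  have hP0 := hP.card_pos
  have hle := card_filter_mul_image_le P k fun x => x • w ∈ A ∪ A₂
  have h₂ : ∑ j, (P.filter fun p => (p * k j) • w ∈ A₂).card ≤ P.card := by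
    simp_rw [Finset.card_filter]
    rw [Finset.sum_comm]
    simp_rw [← Finset.card_filter]
    calc _ ≤ ∑ p ∈ P, 1 := Finset.sum_le_sum fun p hp => hA₂ p hp w
      _ = P.card := by simp
  have h₁ : ∀ j, 8 * (P.filter fun p => (p * k j) • w ∈ A).card ≤ P.card - 1 := by
    intro j
    have := hA (k j • w)
    simp_rw [mul_smul]
    omega
  have hsum : 8 * ((P * Finset.univ.image k).filter fun x => x • w ∈ A ∪ A₂).card ≤
      N * (P.card - 1) + 8 * P.card := by
    calc _ ≤ 8 * ∑ j, (P.filter fun p => (p * k j) • w ∈ A ∪ A₂).card :=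
        Nat.mul_le_mul_left _ hle
      _ ≤ 8 * ∑ j, ((P.filter fun p => (p * k j) • w ∈ A).card +
          (P.filter fun p => (p * k j) • w ∈ A₂).card) := by
        gcongr with j
        simp only [Set.mem_union, Finset.filter_or]
        exact Finset.card_union_le _ _
      _ = ∑ j, 8 * (P.filter fun p => (p * k j) • w ∈ A).card +
          8 * ∑ j, (P.filter fun p => (p * k j) • w ∈ A₂).card := by
        rw [Finset.sum_add_distrib, mul_add, Finset.mul_sum]
      _ ≤ ∑ _j : Fin N, (P.card - 1) + 8 * P.card := by
        gcongr with j
        exact h₁ j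
      _ = _ := by simp
  rw [card_mul_dispersed hW hk]
  obtain ⟨n, hn⟩ : ∃ n, P.card = n + 1 := ⟨P.card - 1, by omega⟩
  rw [hn] at hsum hN ⊢
  simp only [Nat.add_sub_cancel] at hsum
  nlinarith

theorem exists_quartic_lt_two_pow (a C L : ℕ) :
    ∃ n : ℕ, 2 * L * (2 * ((a * n) ^ 2 * ((a * n) ^ 2 + C)) + 1) < 2 ^ n := by
  set D : ℕ := 2 * L * (2 * (a ^ 4 + a ^ 2 * C) + 1) with hD
  have h := tendsto_pow_const_div_const_pow_of_one_lt 4 (one_lt_two : (1 : ℝ) < 2)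
  have hD' : (0 : ℝ) < 1 / (D + 1) := by positivity
  obtain ⟨n, hn, hn1⟩ :=
    ((h.eventually (gt_mem_nhds hD')).and (Filter.eventually_ge_atTop 1)).exists
  refine ⟨n, ?_⟩
  have h₁ : (D + 1) * n ^ 4 < 2 ^ n := by
    rw [div_lt_div_iff₀ (by positivity) (by positivity)] at hn
    have : ((D + 1 : ℕ) : ℝ) * (n : ℝ) ^ 4 < 2 ^ n := by push_cast; linarith
    exact_mod_cast this
  have h₂ : n ^ 2 ≤ n ^ 4 := Nat.pow_le_pow_right hn1 (by norm_num)
  have h₃ : 1 ≤ n ^ 4 := Nat.one_le_pow _ _ hn1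
  calc _ = 2 * L * (2 * (a ^ 4 * n ^ 4 + a ^ 2 * C * n ^ 2) + 1) := by ring
    _ ≤ 2 * L * (2 * (a ^ 4 * n ^ 4 + a ^ 2 * C * n ^ 4) + n ^ 4) := by gcongr
    _ = D * n ^ 4 := by rw [hD]; ring
    _ ≤ (D + 1) * n ^ 4 := by gcongr; omega
    _ < _ := h₁

end Windows

section Coding

theorem exists_of_counts {α : Type*} (P : Finset α) (ow bad : α → Prop) (f : α → Bool) (β : Bool)
    (how : 2 * (P.filter ow).card < P.card) (hbad : 8 * (P.filter bad).card < P.card)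
    (hβ : β ≠ decide (P.card < 8 * (P.filter fun p => ¬ ow p ∧ f p = true).card)) :
    ∃ p ∈ P, ¬ bad p ∧ ¬ ow p ∧ f p ≠ β := by
  by_contra! hcon
  cases β with
  | false =>
    have hlt := of_decide_eq_true (Bool.eq_true_of_not_eq_false hβ.symm)
    have hsub : (P.filter fun p => ¬ ow p ∧ f p = true) ⊆ P.filter bad := by
      intro p hp
      simp only [Finset.mem_filter] at hp ⊢
      refine ⟨hp.1, ?_⟩
      by_contra hb
      have := hcon p hp.1 hb hp.2.1
      simp [this] at hp
    have := Finset.card_le_card hsub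
    omega
  | true =>
    have hle := of_decide_eq_false (Bool.eq_false_of_not_eq_true hβ.symm)
    have hsub : P ⊆ P.filter bad ∪ P.filter ow ∪ P.filter fun p => ¬ ow p ∧ f p = true := by
      intro p hp
      simp only [Finset.mem_union, Finset.mem_filter, hp, true_and]
      by_cases h₁ : bad p
      · exact Or.inl (Or.inl h₁)
      by_cases h₂ : ow p
      · exact Or.inl (Or.inr h₂)
      · exact Or.inr ⟨h₂, hcon p hp h₁ h₂⟩
    have := Finset.card_le_card hsub
    have := Finset.card_union_le (P.filter bad ∪ P.filter ow)
      (P.filter fun p => ¬ ow p ∧ f p = true)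
    have := Finset.card_union_le (P.filter bad) (P.filter ow)
    omega

variable {G : Type*} [Group G] {X : Type*} [MulAction G X] {ι : Type*}

/-- The points `(p * b i) • y` with `p ∈ P` and `y ∈ Y`. -/
def codeSet (P : Finset G) (b : ι → G) (Y : Set X) : Set X :=
  {x | ∃ p ∈ P, ∃ i, (p * b i)⁻¹ • x ∈ Y}

/-- Recolour `c` outside of `A` by writing the letter `v y i` at the points `(p * b i) • y`. -/
noncomputable def recode (P : Finset G) (b : ι → G) (Y A : Set X) (v : X → ι → Bool)
    (c : X → Bool) (x : X) : Bool :=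
  if x ∉ A ∧ x ∈ codeSet P b Y then
    decide (∃ p ∈ P, ∃ i, (p * b i)⁻¹ • x ∈ Y ∧ v ((p * b i)⁻¹ • x) i = true)
  else c x

/-- The letter that `c` shows at index `i` around `z`, outside of the code set. -/
noncomputable def reading (P : Finset G) (b : ι → G) (Y : Set X) (c : X → Bool) (z : X) (i : ι) :
    Bool :=
  decide (P.card < 8 * (P.filter fun p =>
    (p * b i) • z ∉ codeSet P b Y ∧ c ((p * b i) • z) = true).card)

theorem recode_of_notMem {P : Finset G} {b : ι → G} {Y A : Set X} {v : X → ι → Bool}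
    {c : X → Bool} {x : X} (h : x ∉ A → x ∉ codeSet P b Y) : recode P b Y A v c x = c x :=
  if_neg fun hx => h hx.1 hx.2

theorem smul_mem_codeSet {P : Finset G} {b : ι → G} {Y : Set X} {p : G} (hp : p ∈ P) {i : ι}
    {y : X} (hy : y ∈ Y) : (p * b i) • y ∈ codeSet P b Y :=
  ⟨p, hp, i, by rwa [inv_smul_smul]⟩

theorem recode_of_mem {P W : Finset G} (hW : P⁻¹ * P ⊆ W) {b : ι → G} (hb : Dispersed W b)
    {Y A : Set X} (hY : ∀ y ∈ Y, ∀ p ∈ P, ∀ p' ∈ P, ∀ i i',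
      ((p' * b i')⁻¹ * (p * b i)) • y ∈ Y → (p' * b i')⁻¹ * (p * b i) = 1)
    {v : X → ι → Bool} {c : X → Bool} {p : G} (hp : p ∈ P) {i : ι} {y : X} (hy : y ∈ Y)
    (hA : (p * b i) • y ∉ A) : recode P b Y A v c ((p * b i) • y) = v y i := by
  rw [recode, if_pos ⟨hA, smul_mem_codeSet hp hy⟩, Bool.eq_iff_iff, decide_eq_true_iff]
  constructor
  · rintro ⟨p', hp', i', hmem, hv⟩
    rw [← mul_smul] at hmem hv
    have h1 := hY y hy p hp p' hp' i i' hmem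
    rw [h1, one_smul] at hv
    rw [inv_mul_eq_one] at h1
    obtain rfl := mul_dispersed_inj hW hb hp' hp h1
    exact hv
  · intro hv
    exact ⟨p, hp, i, by rwa [inv_smul_smul], by rwa [inv_smul_smul]⟩

/-- Around a point outside of `Y`, at most two indices are mostly overwritten by the code. -/
theorem card_overwritten_le {P W : Finset G} (hW : P⁻¹ * P ⊆ W) {b : ι → G} (hb : Dispersed W b)
    (hP : P.Nonempty) (hov : ∀ t, t ≠ 1 → 2 * (P.filter fun p => p * t ∈ P).card < P.card)
    {Y : Set X} (hY : ∀ y ∈ Y, ∀ p₁ ∈ P, ∀ p₂ ∈ P, ∀ p₃ ∈ P, ∀ p₄ ∈ P, ∀ i₁ i₂ i₃ i₄,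
      ((p₁ * b i₁)⁻¹ * (p₂ * b i₂) * (p₃ * b i₃)⁻¹ * (p₄ * b i₄)) • y ∈ Y →
        (p₁ * b i₁)⁻¹ * (p₂ * b i₂) * (p₃ * b i₃)⁻¹ * (p₄ * b i₄) = 1)
    {z : X} (hz : z ∉ Y) (S : Finset ι)
    (hS : ∀ i ∈ S, P.card ≤ 2 * (P.filter fun p => (p * b i) • z ∈ codeSet P b Y).card) :
    S.card ≤ 2 := by
  rcases S.eq_empty_or_nonempty with rfl | ⟨i₀, hi₀⟩
  · simp
  have hP0 := hP.card_pos
  obtain ⟨p₀, hp₀⟩ : (P.filter fun p => (p * b i₀) • z ∈ codeSet P b Y).Nonempty := by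
    rw [← Finset.card_pos]
    have := hS i₀ hi₀
    omega
  obtain ⟨hp₀, q₀, hq₀, j₀, hy⟩ := Finset.mem_filter.1 hp₀
  set y := (q₀ * b j₀)⁻¹ • (p₀ * b i₀) • z with hydef
  set u := (p₀ * b i₀)⁻¹ * (q₀ * b j₀) with hu
  have hzu : z = u • y := by
    rw [hydef, hu, mul_smul, smul_inv_smul, inv_smul_smul]
  have hu1 : u ≠ 1 := by
    intro h
    rw [h, one_smul] at hzu
    exact hz (hzu ▸ hy)
  refine card_moved_le hW hb u S fun i hi => ?_
  by_contra! hcon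
  have hsub : (P.filter fun p => (p * b i) • z ∈ codeSet P b Y) ⊆
      P.filter fun p => p * (b i * u * (b i)⁻¹) ∈ P := by
    intro p hp
    obtain ⟨hp, q, hq, j, hj⟩ := Finset.mem_filter.1 hp
    rw [hzu, hu, ← mul_smul, ← mul_smul, ← mul_assoc _ (p₀ * b i₀)⁻¹] at hj
    have h1 := hY y hy q hq p hp p₀ hp₀ q₀ hq₀ j i i₀ j₀ hj
    have h2 : p * b i * u = q * b j := by
      rw [mul_assoc, mul_assoc, inv_mul_eq_one] at h1
      rw [h1, hu]
    have hij : i = j := by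
      by_contra hne
      exact hcon p hp q hq j hne h2
    subst hij
    refine Finset.mem_filter.2 ⟨hp, ?_⟩
    have : p * (b i * u * (b i)⁻¹) = q := by
      rw [← mul_assoc, ← mul_assoc, h2]; group
    rwa [this]
  have h₁ := Finset.card_le_card hsub
  have h₂ := hov (b i * u * (b i)⁻¹) (by simpa [mul_inv_eq_one] using hu1)
  have h₃ := hS i hi
  omega

variable [MeasurableSpace X]

theorem measurableSet_codeSet (hBorel : ∀ g : G, Measurable fun x : X => g • x) [Countable ι]
    (P : Finset G) (b : ι → G) {Y : Set X} (hY : MeasurableSet Y) :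
    MeasurableSet (codeSet P b Y) := by
  have : codeSet P b Y = ⋃ p ∈ P, ⋃ i, (fun x => (p * b i)⁻¹ • x) ⁻¹' Y := by
    ext; simp [codeSet]
  rw [this]
  exact P.measurableSet_biUnion fun p _ => MeasurableSet.iUnion fun i => hBorel _ hY

theorem measurable_recode (hBorel : ∀ g : G, Measurable fun x : X => g • x) [Countable ι]
    (P : Finset G) (b : ι → G) {Y A : Set X} (hY : MeasurableSet Y) (hA : MeasurableSet A)
    {v : X → ι → Bool} (hv : Measurable v) {c : X → Bool} (hc : Measurable c) :
    Measurable (recode P b Y A v c) := by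
  refine Measurable.ite (hA.compl.inter (measurableSet_codeSet hBorel P b hY)) ?_ hc
  refine measurable_to_bool ?_
  have : (fun x => decide (∃ p ∈ P, ∃ i, (p * b i)⁻¹ • x ∈ Y ∧
      v ((p * b i)⁻¹ • x) i = true)) ⁻¹' {true} =
      ⋃ p ∈ P, ⋃ i, (fun x => (p * b i)⁻¹ • x) ⁻¹' (Y ∩ (fun y => v y i) ⁻¹' {true}) := by
    ext; simp
  rw [this]
  exact P.measurableSet_biUnion fun p _ => MeasurableSet.iUnion fun i =>
    hBorel _ (hY.inter ((measurable_pi_apply i).comp hv (measurableSet_singleton _)))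

theorem measurable_reading (hBorel : ∀ g : G, Measurable fun x : X => g • x) [Countable ι]
    (P : Finset G) (b : ι → G) {Y : Set X} (hY : MeasurableSet Y) {c : X → Bool}
    (hc : Measurable c) (i : ι) : Measurable fun z => reading P b Y c z i := by
  refine measurable_to_bool ?_
  have hcard : Measurable fun z => (P.filter fun p =>
      (p * b i) • z ∉ codeSet P b Y ∧ c ((p * b i) • z) = true).card := by
    simp_rw [Finset.card_filter]
    refine Finset.measurable_sum _ fun p _ => Measurable.ite ?_ measurable_const measurable_const
    exact (hBorel (p * b i) (measurableSet_codeSet hBorel P b hY).compl).inter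
      (hBorel (p * b i) (hc (measurableSet_singleton true)))
  have : (fun z => reading P b Y c z i) ⁻¹' {true} = {z | P.card < 8 * (P.filter fun p =>
      (p * b i) • z ∉ codeSet P b Y ∧ c ((p * b i) • z) = true).card} := by
    ext; simp [reading]
  rw [this]
  exact measurableSet_lt measurable_const (measurable_const.mul hcard)

end Coding

section Step

variable {G : Type*} [Group G] {X : Type*} [MulAction G X] {ι : Type*}

theorem exists_recode_ne_of_mem {P W : Finset G} (hW : P⁻¹ * P ⊆ W) {b : ι → G}
    (hb : Dispersed W b) {Y A : Set X} (hY : ∀ y ∈ Y, ∀ p ∈ P, ∀ p' ∈ P, ∀ i i',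
      ((p' * b i')⁻¹ * (p * b i)) • y ∈ Y → (p' * b i')⁻¹ * (p * b i) = 1)
    (hA : ∀ w : X, 8 * (P.filter fun p => p • w ∈ A).card < P.card)
    {v : X → ι → Bool} (c : X → Bool) {i : ι} {y z : X} (hy : y ∈ Y) (hz : z ∈ Y)
    (hv : v y i ≠ v z i) :
    ∃ p ∈ P, recode P b Y A v c ((p * b i) • y) ≠ recode P b Y A v c ((p * b i) • z) := by
  by_contra! hcon
  have hsub : P ⊆ (P.filter fun p => p • b i • y ∈ A) ∪ P.filter fun p => p • b i • z ∈ A := by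
    intro p hp
    simp only [Finset.mem_union, Finset.mem_filter, hp, true_and, ← mul_smul]
    by_contra! hA
    have h := hcon p hp
    rw [recode_of_mem hW hb hY hp hy hA.1, recode_of_mem hW hb hY hp hz hA.2] at h
    exact hv h
  have h₁ := (Finset.card_le_card hsub).trans (Finset.card_union_le _ _)
  have h₂ := hA (b i • y)
  have h₃ := hA (b i • z)
  omega

theorem exists_recode_ne_of_reading {P W : Finset G} (hW : P⁻¹ * P ⊆ W) {b : ι → G}
    (hb : Dispersed W b) {Y A : Set X} (hY : ∀ y ∈ Y, ∀ p ∈ P, ∀ p' ∈ P, ∀ i i',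
      ((p' * b i')⁻¹ * (p * b i)) • y ∈ Y → (p' * b i')⁻¹ * (p * b i) = 1)
    (hA : ∀ w : X, 8 * (P.filter fun p => p • w ∈ A).card < P.card)
    {v : X → ι → Bool} {c : X → Bool} {i : ι} {y z : X} (hy : y ∈ Y)
    (hz : 2 * (P.filter fun p => (p * b i) • z ∈ codeSet P b Y).card < P.card)
    (hv : v y i ≠ reading P b Y c z i) :
    ∃ p ∈ P, recode P b Y A v c ((p * b i) • y) ≠ recode P b Y A v c ((p * b i) • z) := by
  have hbad : 8 * (P.filter fun p => (p * b i) • y ∈ A).card < P.card := by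
    simpa only [mul_smul] using hA (b i • y)
  obtain ⟨p, hp, h₁, h₂, h₃⟩ := exists_of_counts P _ _ (fun p => c ((p * b i) • z)) _ hz hbad hv
  refine ⟨p, hp, ?_⟩
  rw [recode_of_mem hW hb hY hp hy h₁, recode_of_notMem fun _ => h₂]
  exact h₃.symm

theorem card_blocks_le {P W : Finset G} (hW : P⁻¹ * P ⊆ W) {J : Type*} {L : ℕ}
    {b : J × Fin L → G} (hb : Dispersed W b) (D : Finset (Fin L)) (φ : G → Prop)
    (h : ∀ l ∉ D, ∃ j, ∃ p ∈ P, φ (p * b (j, l))) {r : G} {T : Finset G}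
    (hT : ∀ p ∈ P, ∀ i, p * b i * r ∈ T) :
    L ≤ (T.filter fun t => φ (t * r⁻¹)).card + D.card := by
  rcases isEmpty_or_nonempty J with hJ | hJ
  · have : D = Finset.univ := Finset.eq_univ_of_forall fun l => by
      by_contra hl
      exact hJ.elim (h l hl).choose
    simp [this]
  choose! j p hp hφ using h
  have : Dᶜ.card ≤ (T.filter fun t => φ (t * r⁻¹)).card := by
    refine Finset.card_le_card_of_injOn (fun l => p l * b (j l, l) * r) ?_ ?_
    · intro l hl
      have hl : l ∉ D := by simpa using hl
      simpa [hT _ (hp l hl)] using hφ l hl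
    · intro l hl l' hl' heq
      have hl : l ∉ D := by simpa using hl
      have hl' : l' ∉ D := by simpa using hl'
      have := mul_dispersed_inj hW hb (hp l hl) (hp l' hl') (mul_right_cancel heq)
      exact congrArg Prod.snd this
  rw [Finset.card_compl, Fintype.card_fin] at this
  omega

/-- If `Q` meets each translate of `P` in at most `m` points, then so it does with each translate of
a union of sufficiently dispersed translates of `P`. -/
theorem card_filter_mul_dispersed_le {P M W Q : Finset G} (hW : P⁻¹ * M * P ⊆ W) {N : ℕ}
    {k : Fin N → G} (hk : Dispersed W k) (hQ : ∀ q ∈ Q, ∀ q' ∈ Q, q * q'⁻¹ ∈ M) {m : ℕ}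
    (hm : ∀ a, (Q.filter fun q => q * a ∈ P).card ≤ m) (a : G) :
    (Q.filter fun q => q * a ∈ P * Finset.univ.image k).card ≤ m := by
  rcases (Q.filter fun q => q * a ∈ P * Finset.univ.image k).eq_empty_or_nonempty with h | ⟨q₀, h₀⟩
  · simp [h]
  simp only [Finset.mem_filter, Finset.mem_mul, Finset.mem_image, Finset.mem_univ, true_and] at h₀
  obtain ⟨hq₀, p₀, hp₀, _, ⟨j₀, rfl⟩, h₀⟩ := h₀
  refine (Finset.card_le_card ?_).trans (hm (a * (k j₀)⁻¹))
  intro q hq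
  simp only [Finset.mem_filter, Finset.mem_mul, Finset.mem_image, Finset.mem_univ, true_and] at hq ⊢
  obtain ⟨hq, p, hp, _, ⟨j, rfl⟩, h⟩ := hq
  refine ⟨hq, ?_⟩
  have hj : j = j₀ := by
    by_contra hne
    refine hk.spread j j₀ hne (hW ?_)
    have : k j * (k j₀)⁻¹ = p⁻¹ * (q * q₀⁻¹) * p₀ := by
      rw [mul_inv_eq_iff_eq_mul, mul_assoc, h₀]
      rw [← inv_mul_eq_iff_eq_mul.2 h.symm]
      group
    rw [this]
    exact Finset.mul_mem_mul (Finset.mul_mem_mul (Finset.inv_mem_inv hp) (hQ q hq q₀ hq₀)) hp₀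
  rw [← mul_assoc, ← h, hj, mul_inv_cancel_right]
  exact hp

theorem card_filter_codeSet_le {P M W Q : Finset G} (hW : P⁻¹ * M * P ⊆ W) {b : ι → G}
    (hb : Dispersed W b) {Y : Set X} (hY : ∀ y ∈ Y, ∀ p ∈ P, ∀ p' ∈ P, ∀ f ∈ M, ∀ i i',
      ((p' * b i')⁻¹ * f * (p * b i)) • y ∈ Y → (p' * b i')⁻¹ * f * (p * b i) = 1)
    (hQ : ∀ q ∈ Q, ∀ q' ∈ Q, q * q'⁻¹ ∈ M) {m : ℕ}
    (hm : ∀ a, (Q.filter fun q => q * a ∈ P).card ≤ m) (x : X) :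
    (Q.filter fun q => q • x ∈ codeSet P b Y).card ≤ m := by
  rcases (Q.filter fun q => q • x ∈ codeSet P b Y).eq_empty_or_nonempty with h | ⟨q₀, h₀⟩
  · simp [h]
  obtain ⟨hq₀, p₀, hp₀, j₀, h₀⟩ := Finset.mem_filter.1 h₀
  refine (Finset.card_le_card ?_).trans (hm (q₀⁻¹ * p₀))
  intro q hq
  obtain ⟨hq, p, hp, j, h⟩ := Finset.mem_filter.1 hq
  refine Finset.mem_filter.2 ⟨hq, ?_⟩
  have hqx : (p * b j)⁻¹ • q • x =
      ((p * b j)⁻¹ * (q * q₀⁻¹) * (p₀ * b j₀)) • (p₀ * b j₀)⁻¹ • q₀ • x := by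
    simp only [← mul_smul]
    congr 1
    group
  rw [hqx] at h
  have h1 := hY _ h₀ p₀ hp₀ p hp _ (hQ q hq q₀ hq₀) j₀ j h
  have h2 : q * q₀⁻¹ * (p₀ * b j₀) = p * b j := by
    rw [mul_assoc, inv_mul_eq_one] at h1
    exact h1.symm
  have hj : j = j₀ := by
    by_contra hne
    refine hb.spread j j₀ hne (hW ?_)
    have : b j * (b j₀)⁻¹ = p⁻¹ * (q * q₀⁻¹) * p₀ := by
      rw [mul_inv_eq_iff_eq_mul, ← inv_mul_eq_iff_eq_mul.2 h2]
      group
    rw [this]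
    exact Finset.mul_mem_mul (Finset.mul_mem_mul (Finset.inv_mem_inv hp) (hQ q hq q₀ hq₀)) hp₀
  rw [hj, ← mul_assoc] at h2
  rwa [← mul_assoc, mul_right_cancel h2]

theorem card_filter_guarded_le_one {P M E W : Finset G} (hW : P⁻¹ * M * E * E⁻¹ * M⁻¹ * P ⊆ W)
    {N : ℕ} {k : Fin N → G} (hk : Dispersed W k) {b : ι → G} (hE : ∀ p ∈ P, ∀ i, p * b i ∈ E)
    {Y : Set X} (hY : ∀ y ∈ Y, ∀ e ∈ E, ∀ e' ∈ E, ∀ f ∈ M, ∀ f' ∈ M, ∀ p ∈ P, ∀ j j',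
      (e'⁻¹ * (f'⁻¹ * (p * k j' * (k j)⁻¹ * p⁻¹) * f) * e) • y ∈ Y →
        e'⁻¹ * (f'⁻¹ * (p * k j' * (k j)⁻¹ * p⁻¹) * f) * e = 1) {p : G} (hp : p ∈ P) (w : X) :
    (Finset.univ.filter fun j => (p * k j) • w ∈ {x | ∃ f ∈ M, f⁻¹ • x ∈ codeSet P b Y}).card
      ≤ 1 := by
  rw [Finset.card_le_one]
  intro j hj j' hj'
  obtain ⟨-, f, hf, q, hq, i, h⟩ := Finset.mem_filter.1 hj
  obtain ⟨-, f', hf', q', hq', i', h'⟩ := Finset.mem_filter.1 hj'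
  have he := hE q hq i
  have he' := hE q' hq' i'
  generalize q * b i = e at h he
  generalize q' * b i' = e' at h' he'
  have hw : e'⁻¹ • f'⁻¹ • (p * k j') • w =
      (e'⁻¹ * (f'⁻¹ * (p * k j' * (k j)⁻¹ * p⁻¹) * f) * e) • e⁻¹ • f⁻¹ • (p * k j) • w := by
    simp only [← mul_smul]
    congr 1
    group
  rw [hw] at h'
  have h1 := hY _ h e he e' he' f hf f' hf' p hp j j' h'
  by_contra hne
  refine hk.spread j' j (Ne.symm hne) (hW ?_)
  have : k j' * (k j)⁻¹ = p⁻¹ * f' * e' * e⁻¹ * f⁻¹ * p := by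
    have h2 : k j' * (k j)⁻¹ = p⁻¹ * f' * e' *
      (e'⁻¹ * (f'⁻¹ * (p * k j' * (k j)⁻¹ * p⁻¹) * f) * e) * e⁻¹ * f⁻¹ * p := by group
    rw [h1] at h2
    rw [h2]; group
  rw [this]
  exact Finset.mul_mem_mul (Finset.mul_mem_mul (Finset.mul_mem_mul (Finset.mul_mem_mul
    (Finset.mul_mem_mul (Finset.inv_mem_inv hp) hf') he') (Finset.inv_mem_inv he))
    (Finset.inv_mem_inv hf)) hp

end Step

section Stages

/-- A stage of the construction of a colouring: the current colouring `color`, the set `used` of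
points whose colour is final, a finite `window` whose translates contain few used points, and a
finite set `guard` recording which configurations later stages may only change once. -/
structure Stage (G X : Type*) where
  window : Finset G
  guard : Finset G
  used : Set X
  color : X → Bool

variable {G : Type*} [Group G] {X : Type*} [MulAction G X]

structure Stage.Admissible [MeasurableSpace X] (s : Stage G X) : Prop where
  nonempty : s.window.Nonempty
  overlap : ∀ t, t ≠ 1 → 2 * (s.window.filter fun p => p * t ∈ s.window).card < s.window.card
  density : ∀ w : X, 8 * (s.window.filter fun p => p • w ∈ s.used).card < s.window.card
  measurableSet_used : MeasurableSet s.used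
  measurable_color : Measurable s.color

/-- The stage `s'` continues `s`, and its colouring distinguishes `t • x` from `(t * g) • x` for
many `t ∈ T`. -/
structure Stage.Refines (s s' : Stage G X) (g : G) (T : Finset G) : Prop where
  guard_subset : s.guard ⊆ s'.guard
  used_subset : s.used ⊆ s'.used
  window_spread : ∀ Q : Finset G, (∀ q ∈ Q, ∀ q' ∈ Q, q * q'⁻¹ ∈ s.guard) → ∀ m,
    (∀ a, (Q.filter fun q => q * a ∈ s.window).card ≤ m) →
      ∀ a, (Q.filter fun q => q * a ∈ s'.window).card ≤ m
  notMem_used : ∀ x, s'.color x ≠ s.color x → x ∉ s.used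
  mem_used : ∀ x, s'.color x ≠ s.color x → ∀ f ∈ s.guard, f • x ∈ s'.used
  mem_guard : ∀ q ∈ T ∪ T * {g}, ∀ q' ∈ T ∪ T * {g}, q * q'⁻¹ ∈ s'.guard
  distinguishes : ∀ x, 2 * s'.window.card <
    (T.filter fun t => s'.color (t • x) ≠ s'.color ((t * g) • x)).card
  sparse : ∀ Q : Finset G, (∀ q ∈ Q, ∀ q' ∈ Q, q * q'⁻¹ ∈ s.guard) → ∀ m,
    (∀ a, (Q.filter fun q => q * a ∈ s.window).card ≤ m) →
      ∀ x, (Q.filter fun q => s'.color (q • x) ≠ s.color (q • x)).card ≤ m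

variable [MeasurableSpace X] [StandardBorelSpace X]

theorem Stage.Admissible.exists_refines [Infinite G]
    (hBorel : ∀ g : G, Measurable fun x : X => g • x)
    (hfree : ∀ (g : G) (x : X), g • x = x → g = 1) {s : Stage G X} (hs : s.Admissible) {g : G}
    (hg : g ≠ 1) : ∃ (s' : Stage G X) (T : Finset G), s'.Admissible ∧ s.Refines s' g T := by
  obtain ⟨P, M, A, c⟩ := s
  obtain ⟨hP, hov, hA, hAm, hc⟩ := hs
  dsimp only at hP hov hA hAm hc
  obtain ⟨N, hN⟩ : ∃ N, 8 * P.card < N := ⟨_, lt_add_one _⟩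
  obtain ⟨L, hL⟩ : ∃ L, 2 * (P.card * N) + 2 < L := ⟨_, lt_add_one _⟩
  obtain ⟨b₀, hb₀⟩ := exists_dispersed (P⁻¹ * P ∪ P⁻¹ * M * P)
  obtain ⟨n, hn⟩ := exists_quartic_lt_two_pow (P.card * 2 * L)
    (M.card + M.card * (P.card * N * N * P.card) * M.card) L
  set b : (Bool × Fin n) × Fin L → G := b₀ ∘ Encodable.encode with hbdef
  have hb : Dispersed (P⁻¹ * P ∪ P⁻¹ * M * P) b := hb₀.comp Encodable.encode_injective
  clear_value b
  set E := P * Finset.univ.image b with hEdef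
  have hE : ∀ p ∈ P, ∀ i, p * b i ∈ E := fun p hp i =>
    Finset.mul_mem_mul hp (Finset.mem_image_of_mem _ (Finset.mem_univ i))
  have hEcard : E.card ≤ P.card * 2 * L * n := by
    refine Finset.card_mul_le.trans ?_
    have : (Finset.univ.image b).card ≤ 2 * n * L := Finset.card_image_le.trans (by simp)
    calc _ ≤ P.card * (2 * n * L) := by gcongr
      _ = _ := by ring
  obtain ⟨k₀, hk₀⟩ := exists_dispersed
    (P⁻¹ * P ∪ P⁻¹ * M * P ∪ P⁻¹ * M * E * E⁻¹ * M⁻¹ * P)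
  set k : Fin N → G := k₀ ∘ Fin.val with hkdef
  have hk : Dispersed (P⁻¹ * P ∪ P⁻¹ * M * P ∪ P⁻¹ * M * E * E⁻¹ * M⁻¹ * P) k :=
    hk₀.comp Fin.val_injective
  clear_value k
  set K := Finset.univ.image k with hKdef
  have hKcard : K.card ≤ N := Finset.card_image_le.trans (by simp)
  have hK : ∀ j, k j ∈ K := fun j => Finset.mem_image_of_mem _ (Finset.mem_univ j)
  set F := E * E⁻¹ ∪ (M ∪ M⁻¹ * (P * K * K⁻¹ * P⁻¹) * M) with hFdef
  set R := E⁻¹ * F * E with hRdef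
  have hRcard : R.card ≤ (P.card * 2 * L * n) ^ 2 * ((P.card * 2 * L * n) ^ 2 +
      (M.card + M.card * (P.card * N * N * P.card) * M.card)) := by
    have hFcard : F.card ≤ E.card * E.card +
        (M.card + M.card * (P.card * N * N * P.card) * M.card) := by
      refine (Finset.card_union_le _ _).trans (add_le_add ?_ ?_)
      · simpa using Finset.card_mul_le (s := E) (t := E⁻¹)
      refine (Finset.card_union_le _ _).trans (add_le_add le_rfl ?_)
      have h₁ : (P * K * K⁻¹ * P⁻¹).card ≤ P.card * N * N * P.card := by
        refine Finset.card_mul_le.trans ?_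
        rw [Finset.card_inv]
        gcongr
        refine Finset.card_mul_le.trans ?_
        rw [Finset.card_inv]
        gcongr
        exact Finset.card_mul_le.trans (by gcongr)
      refine Finset.card_mul_le.trans ?_
      gcongr
      refine Finset.card_mul_le.trans ?_
      rw [Finset.card_inv]
      gcongr
    calc R.card ≤ E.card * F.card * E.card := by
          refine Finset.card_mul_le.trans ?_
          gcongr
          simpa using Finset.card_mul_le (s := E⁻¹) (t := F)
      _ ≤ (P.card * 2 * L * n) * ((P.card * 2 * L * n) * (P.card * 2 * L * n) +
          (M.card + M.card * (P.card * N * N * P.card) * M.card)) * (P.card * 2 * L * n) := by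
        gcongr
        exact hFcard.trans (by gcongr)
      _ = _ := by ring
  obtain ⟨Y, hYm, hYR, hYmax⟩ := exists_measurable_marker hBorel hfree R
  have hY : ∀ y ∈ Y, ∀ e ∈ E, ∀ e' ∈ E, ∀ f ∈ F, (e'⁻¹ * f * e) • y ∈ Y → e'⁻¹ * f * e = 1 :=
    fun y hy e he e' he' f hf => hYR y hy _
      (Finset.mul_mem_mul (Finset.mul_mem_mul (Finset.inv_mem_inv he') hf) he)
  clear hYR
  have hY₂ : ∀ y ∈ Y, ∀ p ∈ P, ∀ p' ∈ P, ∀ i i',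
      ((p' * b i')⁻¹ * (p * b i)) • y ∈ Y → (p' * b i')⁻¹ * (p * b i) = 1 := by
    intro y hy p hp p' hp' i i'
    have := hY y hy _ (hE p hp i) _ (hE p' hp' i') (p * b i * (p * b i)⁻¹)
      (Finset.mem_union_left _ (Finset.mul_mem_mul (hE p hp i) (Finset.inv_mem_inv (hE p hp i))))
    simpa only [mul_inv_cancel, mul_one] using this
  have hY₄ : ∀ y ∈ Y, ∀ p₁ ∈ P, ∀ p₂ ∈ P, ∀ p₃ ∈ P, ∀ p₄ ∈ P, ∀ i₁ i₂ i₃ i₄,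
      ((p₁ * b i₁)⁻¹ * (p₂ * b i₂) * (p₃ * b i₃)⁻¹ * (p₄ * b i₄)) • y ∈ Y →
        (p₁ * b i₁)⁻¹ * (p₂ * b i₂) * (p₃ * b i₃)⁻¹ * (p₄ * b i₄) = 1 := by
    intro y hy p₁ h₁ p₂ h₂ p₃ h₃ p₄ h₄ i₁ i₂ i₃ i₄
    have := hY y hy _ (hE p₄ h₄ i₄) _ (hE p₁ h₁ i₁) (p₂ * b i₂ * (p₃ * b i₃)⁻¹)
      (Finset.mem_union_left _ (Finset.mul_mem_mul (hE p₂ h₂ i₂)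
        (Finset.inv_mem_inv (hE p₃ h₃ i₃))))
    simpa only [mul_assoc] using this
  set S := insert 1 (R ∪ R⁻¹) with hSdef
  set H := S.image fun r => r * g * r⁻¹ with hHdef
  have hHcard : 2 * L * H.card < 2 ^ n := by
    refine lt_of_le_of_lt ?_ hn
    gcongr
    refine Finset.card_image_le.trans ((Finset.card_insert_le _ _).trans ?_)
    gcongr
    refine (Finset.card_union_le _ _).trans ?_
    rw [Finset.card_inv, ← two_mul]
    gcongr
  have hH1 : 1 ∉ H := by
    simp only [hHdef, Finset.mem_image, not_exists, not_and]
    intro r _ h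
    rw [mul_inv_eq_one] at h
    exact hg (by simpa using h)
  obtain ⟨κ, hκ, hκH⟩ := exists_measurable_coloring hBorel hfree H hH1 (C := Fin n → Bool) (by
    have := Finset.card_union_le H H⁻¹
    rw [Finset.card_inv] at this
    have : H.card ≤ L * H.card := Nat.le_mul_of_pos_left _ (by omega)
    simp
    nlinarith)
  obtain ⟨l, hl, hlH⟩ := exists_measurable_avoiding hBorel H (τ := Fin L) (C := Fin n → Bool)
    (by simp; nlinarith) (m := fun z i j => reading P b Y c z ((false, j), i))
    (measurable_pi_lambda _ fun i => measurable_pi_lambda _ fun j =>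
      measurable_reading hBorel P b hYm hc _)
  set v : X → (Bool × Fin n) × Fin L → Bool :=
    fun y i => if i.1.1 = true then κ y i.1.2 else l y i.1.2 with hvdef
  have hv : Measurable v := measurable_pi_lambda _ fun i => by
    by_cases h : i.1.1 = true
    · simp only [hvdef, if_pos h]
      exact (measurable_pi_apply i.1.2).comp hκ
    · simp only [hvdef, if_neg h]
      exact (measurable_pi_apply i.1.2).comp hl
  have hWb : P⁻¹ * P ⊆ P⁻¹ * P ∪ P⁻¹ * M * P := Finset.subset_union_left
  have hWk : P⁻¹ * P ⊆ P⁻¹ * P ∪ P⁻¹ * M * P ∪ P⁻¹ * M * E * E⁻¹ * M⁻¹ * P :=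
    hWb.trans Finset.subset_union_left
  have hchanged : ∀ x, recode P b Y A v c x ≠ c x → x ∉ A ∧ x ∈ codeSet P b Y := by
    intro x hx
    by_contra! h
    exact hx (recode_of_notMem h)
  refine ⟨⟨P * K, M ∪ (E * S ∪ E * S * {g}) * (E * S ∪ E * S * {g})⁻¹,
    A ∪ {x | ∃ f ∈ M, f⁻¹ • x ∈ codeSet P b Y}, recode P b Y A v c⟩, E * S, ?_, ?_⟩
  · refine ⟨?_, fun t ht => overlap_mul hP hov hWk hN hk ht,
      fun w => ?_, hAm.union ?_,
      measurable_recode hBorel P b hYm hAm hv hc⟩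
    · rw [← Finset.card_pos, card_mul_dispersed hWk hk]
      exact Nat.mul_pos hP.card_pos (by omega)
    · convert density_mul (A₂ := {x | ∃ f ∈ M, f⁻¹ • x ∈ codeSet P b Y}) hP hA hWk hN hk ?_ w
      intro p hp w
      convert card_filter_guarded_le_one (Y := Y) Finset.subset_union_right hk hE ?_ hp w
      intro y hy e he e' he' f hf f' hf' p hp j j'
      refine hY y hy e he e' he' _ (Finset.mem_union_right _ (Finset.mem_union_right _ ?_))
      exact Finset.mul_mem_mul (Finset.mul_mem_mul (Finset.inv_mem_inv hf')
        (Finset.mul_mem_mul (Finset.mul_mem_mul (Finset.mul_mem_mul hp (hK j'))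
          (Finset.inv_mem_inv (hK j))) (Finset.inv_mem_inv hp))) hf
    · have : {x : X | ∃ f ∈ M, f⁻¹ • x ∈ codeSet P b Y} =
          ⋃ f ∈ M, (fun x => f⁻¹ • x) ⁻¹' codeSet P b Y := by ext; simp
      rw [this]
      exact M.measurableSet_biUnion fun f _ => hBorel _ (measurableSet_codeSet hBorel P b hYm)
  · constructor
    · exact Finset.subset_union_left
    · exact Set.subset_union_left
    · exact fun Q hQ m hm => card_filter_mul_dispersed_le
        (Finset.subset_union_right.trans Finset.subset_union_left) hk hQ hm
    · exact fun x hx => (hchanged x hx).1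
    · exact fun x hx f hf => Or.inr ⟨f, hf, by simpa using (hchanged x hx).2⟩
    · exact fun q hq q' hq' => Finset.mem_union_right _
        (Finset.mul_mem_mul hq (Finset.inv_mem_inv hq'))
    · intro x
      obtain ⟨r, hr, hy⟩ := hYmax x
      have hh : r * g * r⁻¹ ∈ H := Finset.mem_image_of_mem _ hr
      set y := r • x with hydef
      set z := (r * g * r⁻¹) • y with hzdef
      obtain ⟨D, hD, hblock⟩ : ∃ D : Finset (Fin L), D.card ≤ 2 ∧ ∀ i ∉ D, ∃ j, ∃ p ∈ P,
          recode P b Y A v c ((p * b (j, i)) • y) ≠ recode P b Y A v c ((p * b (j, i)) • z) := by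
        by_cases hz : z ∈ Y
        · refine ⟨∅, by simp, fun i _ => ?_⟩
          obtain ⟨j, hj⟩ := Function.ne_iff.1 (hκH y _ hh)
          exact ⟨(true, j), exists_recode_ne_of_mem hWb hb hY₂ hA c hy hz
            (by simpa [hvdef] using Ne.symm hj)⟩
        · set B : Finset ((Bool × Fin n) × Fin L) := Finset.univ.filter fun i =>
            P.card ≤ 2 * (P.filter fun p => (p * b i) • z ∈ codeSet P b Y).card with hB
          refine ⟨B.image Prod.snd, Finset.card_image_le.trans
            (card_overwritten_le hWb hb hP hov hY₄ hz B fun i hi => (Finset.mem_filter.1 hi).2),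
            fun i hi => ?_⟩
          obtain ⟨j, hj⟩ := Function.ne_iff.1 (hlH y _ hh i)
          refine ⟨(false, j), exists_recode_ne_of_reading hWb hb hY₂ hA hy ?_
            (by simpa [hvdef] using hj)⟩
          by_contra! hcard
          exact hi (Finset.mem_image.2 ⟨((false, j), i), Finset.mem_filter.2
            ⟨Finset.mem_univ _, hcard⟩, rfl⟩)
      have hcount := card_blocks_le hWb hb D
        (fun e => recode P b Y A v c (e • y) ≠ recode P b Y A v c (e • z)) hblock
        (r := r) (T := E * S) fun p hp i => Finset.mul_mem_mul (hE p hp i) hr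
      have hyt : ∀ t : G, (t * r⁻¹) • y = t • x := fun t => by
        rw [hydef, ← mul_smul, inv_mul_cancel_right]
      have hzt : ∀ t : G, (t * r⁻¹) • z = (t * g) • x := fun t => by
        rw [hzdef, hydef, ← mul_smul, ← mul_smul]
        congr 1
        group
      simp only [hyt, hzt] at hcount
      dsimp only
      rw [card_mul_dispersed hWk hk]
      omega
    · intro Q hQ m hm x
      refine (Finset.card_le_card ?_).trans (card_filter_codeSet_le
        (Finset.subset_union_right : P⁻¹ * M * P ⊆ _) hb (Y := Y) ?_ hQ hm x)
      · exact Finset.monotone_filter_right _ fun q _ hq => (hchanged _ hq).2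
      · exact fun y hy p hp p' hp' f hf i i' => hY y hy _ (hE p hp i) _ (hE p' hp' i') f
          (Finset.mem_union_right _ (Finset.mem_union_left _ hf))

end Stages

section Limit

variable {G : Type*} [Group G] {X : Type*} [MulAction G X]

theorem card_filter_window_le {s : ℕ → Stage G X} {γ : ℕ → G} {T : ℕ → Finset G}
    (h : ∀ n, (s n).Refines (s (n + 1)) (γ n) (T n)) {n j : ℕ} (hj : n < j) (a : G) :
    ((T n ∪ T n * {γ n}).filter fun q => q * a ∈ (s j).window).card ≤
      (s (n + 1)).window.card := by
  induction j, hj using Nat.le_induction generalizing a with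
  | base =>
    exact Finset.card_le_card_of_injOn (· * a) (fun q hq => (Finset.mem_filter.1 hq).2)
      fun q _ q' _ => mul_right_cancel
  | succ j hj ih =>
    have hmono : Monotone fun n => (s n).guard :=
      monotone_nat_of_le_succ fun n => (h n).guard_subset
    exact (h j).window_spread _ (fun q hq q' hq' => hmono hj ((h n).mem_guard q hq q' hq')) _ ih a

/-- All later changes among the points `q • x` with `q` in the set guarded at stage `n` happen at a
single stage. -/
theorem card_changed_le {s : ℕ → Stage G X} {γ : ℕ → G} {T : ℕ → Finset G}
    (h : ∀ n, (s n).Refines (s (n + 1)) (γ n) (T n)) (n : ℕ) (x : X) :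
    ((T n ∪ T n * {γ n}).filter fun q =>
      ∃ j > n, (s (j + 1)).color (q • x) ≠ (s j).color (q • x)).card ≤
      (s (n + 1)).window.card := by
  set Q := T n ∪ T n * {γ n} with hQ
  have hguard : ∀ j > n, ∀ q ∈ Q, ∀ q' ∈ Q, q * q'⁻¹ ∈ (s j).guard := by
    have hmono : Monotone fun n => (s n).guard :=
      monotone_nat_of_le_succ fun n => (h n).guard_subset
    exact fun j hj q hq q' hq' => hmono hj ((h n).mem_guard q hq q' hq')
  have hused : Monotone fun n => (s n).used := monotone_nat_of_le_succ fun n => (h n).used_subset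
  by_cases hex : ∃ j > n, ∃ q ∈ Q, (s (j + 1)).color (q • x) ≠ (s j).color (q • x)
  · obtain ⟨hj, q₀, hq₀, h₀⟩ := Nat.find_spec hex
    have hmin := fun m => @Nat.find_min _ _ hex m
    generalize Nat.find hex = j at hj h₀ hmin
    refine (Finset.card_le_card ?_).trans
      ((h j).sparse Q (hguard j hj) _ (card_filter_window_le h hj) x)
    intro q hq
    obtain ⟨hq, i, hi, hqi⟩ := Finset.mem_filter.1 hq
    refine Finset.mem_filter.2 ⟨hq, ?_⟩
    rcases lt_trichotomy i j with hij | rfl | hij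
    · exact absurd ⟨hi, q, hq, hqi⟩ (hmin i hij)
    · exact hqi
    · have h₁ := (h j).mem_used _ h₀ _ (hguard j hj q hq q₀ hq₀)
      rw [← mul_smul, inv_mul_cancel_right] at h₁
      exact absurd (hused hij h₁) ((h i).notMem_used _ hqi)
  · push Not at hex
    rw [Finset.filter_false_of_mem]
    · simp
    · rintro q hq ⟨j, hj, hne⟩
      exact hne (hex j hj q hq)

/-- There is a Borel colouring that distinguishes `t • x` from `(t * g) • x` for some `t` in a
finite set depending only on `g`. -/
theorem exists_distinguishing_coloring [Countable G] [Infinite G] [MeasurableSpace X]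
    [StandardBorelSpace X] (hBorel : ∀ g : G, Measurable fun x : X => g • x)
    (hfree : ∀ (g : G) (x : X), g • x = x → g = 1) :
    ∃ c : X → Bool, Measurable c ∧ ∀ g : G, g ≠ 1 → ∃ T : Finset G, ∀ x, ∃ t ∈ T,
      c (t • x) ≠ c ((t * g) • x) := by
  obtain ⟨g₀, hg₀⟩ := exists_ne (1 : G)
  have : Nonempty {g : G // g ≠ 1} := ⟨⟨g₀, hg₀⟩⟩
  obtain ⟨γ, hγ⟩ := exists_surjective_nat {g : G // g ≠ 1}
  choose step T hstep href using fun (s : {s : Stage G X // s.Admissible}) (g : {g : G // g ≠ 1}) =>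
    s.2.exists_refines hBorel hfree g.2
  let s : ℕ → {s : Stage G X // s.Admissible} := fun n =>
    Nat.rec ⟨⟨{1}, ∅, ∅, fun _ => false⟩, by
      refine ⟨by simp, fun t ht => ?_, by simp, MeasurableSet.empty, measurable_const⟩
      simp [Finset.filter_singleton, ht]⟩ (fun n s => ⟨step s (γ n), hstep s (γ n)⟩) n
  have h : ∀ n, (s n).1.Refines (s (n + 1)).1 (γ n) (T (s n) (γ n)) := fun n => href (s n) (γ n)
  generalize hS : (fun n => (s n).1) = S
  generalize hU : (fun n => T (s n) (γ n)) = U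
  have hS' : ∀ n, (S n).Admissible := fun n => hS ▸ (s n).2
  replace h : ∀ n, (S n).Refines (S (n + 1)) (γ n) (U n) := fun n => hS ▸ hU ▸ h n
  refine ⟨fun x => decide (∃ n, ∀ j, n ≤ j → (S j).color x = true), ?_, fun g hg => ?_⟩
  · refine measurable_to_bool ?_
    have : (fun x => decide (∃ n, ∀ j, n ≤ j → (S j).color x = true)) ⁻¹' {true} =
        ⋃ n, ⋂ j, ⋂ _ : n ≤ j, (S j).color ⁻¹' {true} := by ext; simp
    rw [this]
    exact MeasurableSet.iUnion fun n => MeasurableSet.iInter fun j => MeasurableSet.iInter fun _ =>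
      (hS' j).measurable_color (measurableSet_singleton _)
  obtain ⟨n, hn⟩ := hγ ⟨g, hg⟩
  refine ⟨U n, fun x => ?_⟩
  have hlim : ∀ y, (∀ j > n, (S (j + 1)).color y = (S j).color y) →
      decide (∃ n, ∀ j, n ≤ j → (S j).color y = true) = (S (n + 1)).color y := by
    intro y hy
    have hconst : ∀ j, n + 1 ≤ j → (S j).color y = (S (n + 1)).color y := by
      intro j hj
      induction j, hj using Nat.le_induction with
      | base => rfl
      | succ j hj ih => rw [hy j hj, ih]
    rw [Bool.eq_iff_iff, decide_eq_true_iff]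
    constructor
    · rintro ⟨m, hm⟩
      rw [← hconst _ (le_max_left (n + 1) m)]
      exact hm _ (le_max_right _ _)
    · exact fun h => ⟨n + 1, fun j hj => (hconst j hj).trans h⟩
  have hγn : (γ n : G) = g := by rw [hn]
  have hdist := (h n).distinguishes x
  have hcard := card_changed_le h n x
  rw [hγn] at hdist hcard
  by_contra! hcon
  set V := (U n ∪ U n * {g}).filter fun q =>
    ∃ j > n, (S (j + 1)).color (q • x) ≠ (S j).color (q • x) with hV
  have hsub : (U n).filter (fun t => (S (n + 1)).color (t • x) ≠ (S (n + 1)).color ((t * g) • x)) ⊆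
      V ∪ V.image (· * g⁻¹) := by
    intro t ht
    obtain ⟨ht, hne⟩ := Finset.mem_filter.1 ht
    by_contra hnot
    simp only [Finset.mem_union, Finset.mem_image, not_or, not_exists, not_and] at hnot
    refine hne ?_
    rw [← hlim (t • x), ← hlim ((t * g) • x)]
    · exact hcon t ht
    · by_contra! hex
      exact hnot.2 (t * g) (Finset.mem_filter.2 ⟨Finset.mem_union_right _
        (Finset.mul_mem_mul ht (Finset.mem_singleton_self g)), hex⟩) (mul_inv_cancel_right t g)
    · by_contra! hex
      exact hnot.1 (Finset.mem_filter.2 ⟨Finset.mem_union_left _ ht, hex⟩)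
  have h₁ := (Finset.card_le_card hsub).trans (Finset.card_union_le _ _)
  have h₂ : (V.image (· * g⁻¹)).card ≤ V.card := Finset.card_image_le
  omega

end Limit

/-- For any countably infinite group `G` and any free Borel action `G ↷ X` on a standard
Borel space there is a `G`-equivariant Borel map `f : X → 2^G` whose image has closure
contained in the free part of the 2-shift. -/
theorem equivariant_map_into_free_part
    {G : Type*} [Group G] [Countable G] [Infinite G]
    {X : Type*} [MeasurableSpace X] [StandardBorelSpace X] [MulAction G X]
    (hBorel : ∀ g : G, Measurable fun x : X => g • x)
    (hfree : ∀ (g : G) (x : X), g • x = x → g = 1) :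
    ∃ f : X → (G → Bool),
      Measurable f ∧
      (∀ (g : G) (x : X), f (g • x) = shift g (f x)) ∧
      closure (Set.range f) ⊆ FreePart G := by
  obtain ⟨c, hc, hdist⟩ := exists_distinguishing_coloring hBorel hfree
  refine ⟨fun x h => c (h⁻¹ • x), measurable_pi_lambda _ fun h => hc.comp (hBorel h⁻¹), ?_, ?_⟩
  · intro g x
    funext h
    simp only [shift, mul_inv_rev, inv_inv, mul_smul]
  · intro w hw g hg hshift
    obtain ⟨T, hT⟩ := hdist g hg
    have hopen : IsOpen {u : G → Bool | ∀ h ∈ T⁻¹ ∪ {g⁻¹} * T⁻¹, u h = w h} := by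
      have : {u : G → Bool | ∀ h ∈ T⁻¹ ∪ {g⁻¹} * T⁻¹, u h = w h} =
          ⋂ h ∈ T⁻¹ ∪ {g⁻¹} * T⁻¹, (fun u : G → Bool => u h) ⁻¹' {w h} := by
        ext; simp only [Set.mem_iInter, Set.mem_preimage, Set.mem_singleton_iff]; rfl
      rw [this]
      exact isOpen_biInter_finset fun h _ => (isOpen_discrete _).preimage (continuous_apply h)
    obtain ⟨_, hu, x, rfl⟩ := mem_closure_iff.1 hw _ hopen fun h _ => rfl
    obtain ⟨t, ht, hne⟩ := hT x
    have h₁ := hu t⁻¹ (Finset.mem_union_left _ (Finset.inv_mem_inv ht))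
    have h₂ := hu (g⁻¹ * t⁻¹) (Finset.mem_union_right _
      (Finset.mul_mem_mul (Finset.mem_singleton_self _) (Finset.inv_mem_inv ht)))
    have h₃ : w (g⁻¹ * t⁻¹) = w t⁻¹ := congrFun hshift t⁻¹
    simp only [inv_inv, mul_inv_rev] at h₁ h₂
    exact hne (by rw [h₁, h₂, h₃])
end

section
/- Let G be a countably infinite discrete group and let G ↷ X be a free Borel action on a standard Borel space X. Suppose Y ⊆ X is a Borel set such that X \ Y is syndetic, and φ : Y → {0,1} is a Borel function. Then there exists a G-equivariant Borel map f : X → 2^G such that the closure of f(X) is contained in Free(2^G) and f(y)(1_G) = φ(y) for all y ∈ Y. -/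
open MeasureTheory Set

/-- `M ⊆ X` is syndetic if `F • M = X` for some finite `F ⊆ G`. -/
def Syndetic {G X : Type*} [Group G] [MulAction G X] (M : Set X) : Prop :=
  ∃ F : Finset G, ∀ x : X, ∃ g ∈ F, g⁻¹ • x ∈ M

section GreedyColoring

open scoped Pointwise

theorem exists_measurable_selection {X V : Type*} [MeasurableSpace X] [Countable V]
    (P : X → V → Prop) (hP : ∀ p, MeasurableSet {x | P x p}) (hex : ∀ x, ∃ p, P x p) :
    ∃ v : X → V, (∀ p, MeasurableSet {x | v x = p}) ∧ ∀ x, P x (v x) := by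
  classical
  rcases isEmpty_or_nonempty X with hX | ⟨⟨x₀⟩⟩
  · exact ⟨fun x => isEmptyElim x, fun p => by simp [Set.eq_empty_of_isEmpty], fun x => isEmptyElim x⟩
  have : Nonempty V := ⟨(hex x₀).choose⟩
  obtain ⟨u, hu⟩ := exists_surjective_nat V
  have hex' : ∀ x, ∃ n, P x (u n) := fun x => by
    obtain ⟨p, hp⟩ := hex x
    obtain ⟨n, rfl⟩ := hu p
    exact ⟨n, hp⟩
  have hm : Measurable fun x => Nat.find (hex' x) := measurable_find hex' fun k => hP (u k)
  exact ⟨fun x => u (Nat.find (hex' x)),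
    fun p => hm (MeasurableSet.of_discrete (s := {n | u n = p})),
    fun x => Nat.find_spec (hex' x)⟩

theorem exists_measurable_coloring_s1 {G X : Type*} [Group G] [MeasurableSpace X]
    [StandardBorelSpace X] [MulAction G X] [MeasurableConstSMul G X]
    (hfree : ∀ (g : G) (x : X), g • x = x → g = 1) (K : Finset G) :
    ∃ κ : X → ℕ, Measurable κ ∧ ∀ x, ∀ k ∈ K, k ≠ 1 → κ (k • x) ≠ κ x := by
  classical
  let e := MeasurableSpace.mapNatBool X
  have he : Measurable e := MeasurableSpace.measurable_mapNatBool X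
  have hei : Function.Injective e := MeasurableSpace.injective_mapNatBool X
  have hek : ∀ (i : ℕ), Measurable fun x => e x i := fun i => (measurable_pi_apply i).comp he
  have hek' : ∀ (k : G) (i : ℕ), Measurable fun x => e (k • x) i :=
    fun k i => (hek i).comp (measurable_const_smul k)
  obtain ⟨v, hv, hvP⟩ := exists_measurable_selection
    (fun (x : X) (s : ℕ × Finset ℕ) => (∀ i < s.1, (e x i = true ↔ i ∈ s.2)) ∧
      ∀ k ∈ K, k ≠ 1 → ∃ i < s.1, e x i ≠ e (k • x) i) (by
      intro s
      refine MeasurableSet.inter (s₁ := {x | ∀ i < s.1, (e x i = true ↔ i ∈ s.2)}) ?_ ?_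
      · simp only [Set.ofPred_forall]
        refine MeasurableSet.iInter fun i => MeasurableSet.iInter fun _ => ?_
        exact hek i (MeasurableSet.of_discrete (s := {b | b = true ↔ i ∈ s.2}))
      · change MeasurableSet {x | ∀ k ∈ K, k ≠ 1 → ∃ i, i < s.1 ∧ e x i ≠ e (k • x) i}
        simp only [Set.ofPred_forall, Set.ofPred_exists, Set.ofPred_and]
        refine Finset.measurableSet_biInter _ fun k _ => MeasurableSet.iInter fun _ =>
          MeasurableSet.iUnion fun i => (MeasurableSet.const _).inter ?_
        exact (measurableSet_eq_fun (hek i) (hek' k i)).compl)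
    (by
      intro x
      have : ∀ k : G, ∃ i, k ≠ 1 → e x i ≠ e (k • x) i := fun k => by
        by_cases hk : k = 1
        · exact ⟨0, fun h => absurd hk h⟩
        by_contra! hcon
        exact hk (hfree k x (hei (funext fun i => (hcon i).2)).symm)
      choose i hi using this
      refine ⟨(K.sup i + 1, (Finset.range (K.sup i + 1)).filter fun j => e x j = true), ?_, ?_⟩
      · intro j hj
        simp only at hj
        simp only [Finset.mem_filter, Finset.mem_range, hj, true_and]
      · exact fun k hk hk1 => ⟨i k, Nat.lt_succ_of_le (Finset.le_sup hk), hi k hk1⟩)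
  refine ⟨fun x => Encodable.encode (v x), ?_, ?_⟩
  · refine measurable_to_countable' fun n => ?_
    have : (fun x => Encodable.encode (v x)) ⁻¹' {n}
        = ⋃ s ∈ {s : ℕ × Finset ℕ | Encodable.encode s = n}, {x | v x = s} := by
      ext x; simp
    rw [this]
    exact MeasurableSet.biUnion (Set.to_countable _) fun s _ => hv s
  · intro x k hk hk1 heq
    have heq := Encodable.encode_injective heq
    obtain ⟨i, hi, hne⟩ := (hvP x).2 k hk hk1
    have h1 := (hvP x).1 i hi
    have h2 := (hvP (k • x)).1 i (heq ▸ hi)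
    rw [heq, ← h1] at h2
    exact hne (Bool.eq_iff_iff.2 h2.symm)

theorem exists_measurable_maximal_separated {G X : Type*} [Group G] [MeasurableSpace X]
    [StandardBorelSpace X] [MulAction G X] [MeasurableConstSMul G X]
    (hfree : ∀ (g : G) (x : X), g • x = x → g = 1) (K : Finset G) (hK : ∀ k ∈ K, k⁻¹ ∈ K)
    (U : Set X) (hU : MeasurableSet U) :
    ∃ Z ⊆ U, MeasurableSet Z ∧ (∀ z ∈ Z, ∀ k ∈ K, k • z ∈ Z → k = 1) ∧
      ∀ x ∈ U, x ∈ Z ∨ ∃ k ∈ K, k • x ∈ Z := by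
  classical
  obtain ⟨κ, hκ, hκK⟩ := exists_measurable_coloring_s1 hfree K
  let W : ℕ → Set X := fun n => Nat.rec ∅
    (fun n W => W ∪ {x | x ∈ U ∧ κ x = n ∧ ∀ k ∈ K, k • x ∉ W}) n
  have hW : ∀ n, W (n + 1) = W n ∪ {x | x ∈ U ∧ κ x = n ∧ ∀ k ∈ K, k • x ∉ W n} := fun n => rfl
  have hWm : ∀ n, MeasurableSet (W n) := by
    intro n
    induction n with
    | zero => exact MeasurableSet.empty
    | succ n ih =>
      rw [hW]
      refine ih.union (hU.inter (MeasurableSet.inter (hκ (measurableSet_singleton n)) ?_))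
      change MeasurableSet {x | ∀ k ∈ K, k • x ∉ W n}
      simp only [Set.ofPred_forall]
      exact Finset.measurableSet_biInter _ fun k _ => (measurable_const_smul k ih).compl
  have hmono : Monotone W := monotone_nat_of_le_succ fun n => by
    rw [hW]; exact subset_union_left
  have hspec : ∀ n x, x ∈ W n → x ∈ U ∧ x ∈ W (κ x + 1) ∧ ∀ k ∈ K, k • x ∉ W (κ x) := by
    intro n
    induction n with
    | zero => intro x hx; exact hx.elim
    | succ n ih =>
      intro x hx
      rcases (hW n ▸ hx : _) with h | h
      · exact ih x h
      · obtain ⟨h1, rfl, h3⟩ := h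
        exact ⟨h1, hx, h3⟩
  refine ⟨⋃ n, W n, ?_, MeasurableSet.iUnion hWm, ?_, ?_⟩
  · intro x hx
    obtain ⟨n, hn⟩ := mem_iUnion.1 hx
    exact (hspec n x hn).1
  · intro z hz k hk hkz
    by_contra hk1
    obtain ⟨n, hn⟩ := mem_iUnion.1 hz
    obtain ⟨n', hn'⟩ := mem_iUnion.1 hkz
    obtain ⟨-, h1, h2⟩ := hspec _ _ hn
    obtain ⟨-, h1', h2'⟩ := hspec _ _ hn'
    rcases lt_or_gt_of_ne (hκK z k hk hk1) with hlt | hlt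
    · exact h2 k hk (hmono hlt h1')
    · refine h2' k⁻¹ (hK k hk) ?_
      rw [inv_smul_smul]
      exact hmono hlt h1
  · intro x hx
    rcases em (∃ k ∈ K, k • x ∈ W (κ x)) with h | h
    · obtain ⟨k, hk, hkx⟩ := h
      exact Or.inr ⟨k, hk, mem_iUnion.2 ⟨_, hkx⟩⟩
    · push Not at h
      refine Or.inl (mem_iUnion.2 ⟨κ x + 1, ?_⟩)
      rw [hW]
      exact Or.inr ⟨hx, rfl, h⟩

theorem Finset.exists_subset_mul_right_notMem {G : Type*} [Group G] (Q : Finset G) {h : G}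
    (hh : h ≠ 1) : ∃ I ⊆ Q, (∀ d ∈ I, d * h ∉ I) ∧ Q.card ≤ 3 * I.card := by
  classical
  obtain ⟨I, hI, hmax⟩ := (Q.powerset.filter fun I => ∀ d ∈ I, d * h ∉ I).exists_max_image
    Finset.card ⟨∅, by simp⟩
  simp only [Finset.mem_filter, Finset.mem_powerset] at hI hmax
  refine ⟨I, hI.1, hI.2, ?_⟩
  have hsub : Q ⊆ I ∪ (I.image (· * h) ∪ I.image (· * h⁻¹)) := by
    intro d hd
    by_contra hcon
    simp only [Finset.mem_union, Finset.mem_image, not_or, not_exists, not_and] at hcon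
    obtain ⟨h1, h2, h3⟩ := hcon
    have := hmax (insert d I) ⟨Finset.insert_subset hd hI.1, by
      intro a ha hah
      rcases Finset.mem_insert.1 ha with rfl | ha
      · rcases Finset.mem_insert.1 hah with e | hah
        · exact hh (by simpa using e)
        · exact h3 _ hah (by simp)
      · rcases Finset.mem_insert.1 hah with e | hah
        · exact h2 a ha e
        · exact hI.2 a ha hah⟩
    rw [Finset.card_insert_of_notMem h1] at this
    omega
  have h1 := Finset.card_le_card hsub
  have h2 := Finset.card_union_le I (I.image (· * h) ∪ I.image (· * h⁻¹))
  have h3 := Finset.card_union_le (I.image (· * h)) (I.image (· * h⁻¹))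
  have h4 : (I.image (· * h)).card ≤ I.card := Finset.card_image_le
  have h5 : (I.image (· * h⁻¹)).card ≤ I.card := Finset.card_image_le
  omega

theorem Finset.card_mul_two_pow_le_of_injOn_sdiff {G : Type*} [DecidableEq G] {D J : Finset G}
    (hJ : J ⊆ D) {B : Finset (Finset G)} (hB : B ⊆ D.powerset)
    (hinj : ∀ p ∈ B, ∀ q ∈ B, p \ J = q \ J → p = q) : B.card * 2 ^ J.card ≤ 2 ^ D.card := by
  have h1 : B.card ≤ (D \ J).powerset.card :=
    Finset.card_le_card_of_injOn (· \ J)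
      (fun p hp => Finset.mem_coe.2 (Finset.mem_powerset.2
        (Finset.sdiff_subset_sdiff (Finset.mem_powerset.1 (hB hp)) le_rfl)))
      (fun p hp q hq h => hinj p hp q hq h)
  rw [Finset.card_powerset] at h1
  calc B.card * 2 ^ J.card ≤ 2 ^ (D \ J).card * 2 ^ J.card := Nat.mul_le_mul_right _ h1
    _ = 2 ^ D.card := by rw [← pow_add, Finset.card_sdiff_add_card_eq_card hJ]

theorem exists_mul_pow_lt_two_pow (C j : ℕ) : ∃ m : ℕ, C * (m + 1) ^ j < 2 ^ m := by
  have h := (isLittleO_pow_const_const_pow_of_one_lt (R := ℝ) j (one_lt_two)).def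
    (c := 1 / (2 * ((C : ℝ) + 1))) (by positivity)
  obtain ⟨n, hn⟩ := Filter.eventually_atTop.1 h
  refine ⟨n, ?_⟩
  have := hn (n + 1) (by omega)
  rw [Real.norm_of_nonneg (by positivity), Real.norm_of_nonneg (by positivity),
    one_div, ← div_eq_inv_mul, le_div_iff₀ (by positivity), pow_succ 2] at this
  have h2 : (0 : ℝ) < ((n : ℝ) + 1) ^ j := by positivity
  have : (C : ℝ) * ((n : ℝ) + 1) ^ j < 2 ^ n := by
    push_cast at this
    nlinarith
  exact_mod_cast this

/-- The values, read around `z`, of the partial coloring obtained from `c` by filling the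
uncolored points of the block `D • z` according to the pattern `p`. -/
def fillAt {G X : Type*} [Group G] [MulAction G X] [DecidableEq G] (D : Finset G)
    (c : X → Option Bool) (p : Finset G) (z : X) (e : G) : Option Bool :=
  (c (e • z)).or (if e ∈ D then some (decide (e ∈ p)) else none)

/-- Some translate by `D` sees two different known values, at `r` and at `h * r`. -/
def Discriminates {G : Type*} [Group G] (D : Finset G) (L : G → Option Bool) (r h : G) : Prop :=
  ∃ d ∈ D, ∃ α, L (d * r) = some α ∧ L (d * h * r) = some (!α)

open Classical in
theorem measurableSet_discriminates_fillAt {G X : Type*} [Group G] [Countable G]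
    [MeasurableSpace X] [MulAction G X] [MeasurableConstSMul G X] (D : Finset G) (c : X → Option Bool)
    (hc : ∀ o, MeasurableSet (c ⁻¹' {o})) (p : Finset G) (r h : G) :
    MeasurableSet {z | Discriminates D (fillAt D c p z) r h} := by
  have hfill : ∀ (e : G) (o : Option Bool), MeasurableSet {z | fillAt D c p z e = o} := by
    intro e o
    have : {z : X | fillAt D c p z e = o} = ⋃ o' ∈ {o' : Option Bool |
        o'.or (if e ∈ D then some (decide (e ∈ p)) else none) = o}, {z | c (e • z) = o'} := by
      ext z; simp [fillAt]
    rw [this]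
    exact MeasurableSet.biUnion (Set.to_countable _) fun o' _ => measurable_const_smul e (hc o')
  simp only [Discriminates, Set.ofPred_exists]
  refine MeasurableSet.iUnion fun d => ?_
  simp only [Set.ofPred_and, Set.ofPred_exists]
  exact (MeasurableSet.const _).inter (MeasurableSet.iUnion fun α => (hfill _ _).inter (hfill _ _))

open Classical in
theorem exists_measurable_good_pattern {G X : Type*} [Group G] [Countable G] [MeasurableSpace X]
    [MulAction G X] [MeasurableConstSMul G X] (D R H : Finset G) (m : ℕ)
    (hm : R.card * H.card < 2 ^ m) (c : X → Option Bool) (hc : ∀ o, MeasurableSet (c ⁻¹' {o})) :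
    ∃ v : X → Finset G, (∀ p, MeasurableSet {x | v x = p}) ∧
      ∀ z, ∀ r ∈ R, ∀ h ∈ H,
        (D.powerset.filter fun p => ¬ Discriminates D (fillAt D c p z) r h).card * 2 ^ m
          ≤ 2 ^ D.card → Discriminates D (fillAt D c (v z) z) r h := by
  refine exists_measurable_selection (fun z q => ∀ r ∈ R, ∀ h ∈ H,
        (D.powerset.filter fun p => ¬ Discriminates D (fillAt D c p z) r h).card * 2 ^ m
          ≤ 2 ^ D.card → Discriminates D (fillAt D c q z) r h) ?_ ?_
  · intro q
    simp only [Set.ofPred_forall]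
    refine Finset.measurableSet_biInter _ fun r _ => Finset.measurableSet_biInter _ fun h _ => ?_
    have h1 := measurableSet_discriminates_fillAt D c hc
    have h2 : Measurable fun z =>
        (D.powerset.filter fun p => ¬ Discriminates D (fillAt D c p z) r h).card := by
      simp only [Finset.card_filter]
      exact Finset.measurable_sum _ fun p _ =>
        Measurable.ite (h1 p r h).compl measurable_const measurable_const
    refine MeasurableSet.imp ?_ (h1 q r h)
    exact h2 (MeasurableSet.of_discrete (s := {n | n * 2 ^ m ≤ 2 ^ D.card}))
  · intro z
    by_contra! hcon
    let S := (R ×ˢ H).filter fun i =>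
      (D.powerset.filter fun p => ¬ Discriminates D (fillAt D c p z) i.1 i.2).card * 2 ^ m
        ≤ 2 ^ D.card
    have hsub : D.powerset ⊆ S.biUnion fun i =>
        D.powerset.filter fun p => ¬ Discriminates D (fillAt D c p z) i.1 i.2 := by
      intro p hp
      obtain ⟨r, hr, h, hh, hle, hbad⟩ := hcon p
      exact Finset.mem_biUnion.2 ⟨(r, h), Finset.mem_filter.2 ⟨Finset.mk_mem_product hr hh, hle⟩,
        Finset.mem_filter.2 ⟨hp, hbad⟩⟩
    have h1 := (Finset.card_le_card hsub).trans Finset.card_biUnion_le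
    rw [Finset.card_powerset] at h1
    have h2 : 2 ^ D.card * 2 ^ m ≤ S.card * 2 ^ D.card := by
      refine (Nat.mul_le_mul_right _ h1).trans ?_
      rw [Finset.sum_mul]
      refine (Finset.sum_le_card_nsmul S _ (2 ^ D.card) fun i hi => (Finset.mem_filter.1 hi).2).trans
        (by simp)
    have h3 : S.card < 2 ^ m := lt_of_le_of_lt
      ((Finset.card_filter_le _ _).trans (Finset.card_product _ _).le) hm
    have h4 : 0 < 2 ^ D.card := by positivity
    nlinarith

open Classical in
/-- One step of the greedy procedure: fill the blocks `D • z` for `z` in the set `A`. -/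
theorem exists_measurable_fill {G X : Type*} [Group G] [Countable G] [MeasurableSpace X]
    [MulAction G X] [MeasurableConstSMul G X] (D R H : Finset G) (m : ℕ)
    (hm : R.card * H.card < 2 ^ m) (A : Set X) (hA : MeasurableSet A)
    (hsep : ∀ d ∈ D, ∀ d' ∈ D, ∀ z ∈ A, ∀ z' ∈ A, d • z = d' • z' → z = z')
    (hfree : ∀ (g : G) (x : X), g • x = x → g = 1)
    (c : X → Option Bool) (hc : ∀ o, MeasurableSet (c ⁻¹' {o})) :
    ∃ c' : X → Option Bool, (∀ o, MeasurableSet (c' ⁻¹' {o})) ∧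
      (∀ b α, c b = some α → c' b = some α) ∧
      (∀ b, c b = none → (∀ d ∈ D, d⁻¹ • b ∉ A) → c' b = none) ∧
      (∀ d ∈ D, ∀ z ∈ A, c' (d • z) ≠ none) ∧
      ∀ z ∈ A, ∀ r ∈ R, ∀ h ∈ H,
        (D.powerset.filter fun p => ¬ Discriminates D (fillAt D c p z) r h).card * 2 ^ m
          ≤ 2 ^ D.card → ∃ d ∈ D, ∃ α, c' ((d * r) • z) = some α ∧
            c' ((d * h * r) • z) = some (!α) := by
  obtain ⟨v, hv, hgood⟩ := exists_measurable_good_pattern D R H m hm c hc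
  let c' : X → Option Bool := fun b => (c b).or (if ∃ d ∈ D, d⁻¹ • b ∈ A then
    some (decide (∃ d ∈ D, d⁻¹ • b ∈ A ∧ d ∈ v (d⁻¹ • b))) else none)
  have hfill : ∀ z ∈ A, ∀ e α, fillAt D c (v z) z e = some α → c' (e • z) = some α := by
    intro z hz e α h
    simp only [fillAt] at h
    simp only [c']
    cases hce : c (e • z) with
    | some β => simpa [hce] using h
    | none =>
      simp only [hce, Option.none_or, Option.ite_none_right_eq_some] at h ⊢
      obtain ⟨heD, h⟩ := h
      refine ⟨⟨e, heD, by simpa using hz⟩, ?_⟩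
      rw [← h]
      congr 2
      refine propext ⟨?_, fun he => ⟨e, heD, by simpa using hz, by simpa using he⟩⟩
      rintro ⟨d, hd, hdA, hdv⟩
      have h1 := hsep d hd e heD _ hdA z hz (smul_inv_smul _ _)
      rw [h1] at hdv
      have h2 : (d⁻¹ * e) • z = z := by rw [mul_smul, h1]
      have h3 := inv_mul_eq_one.1 (hfree _ _ h2)
      rwa [← h3]
  refine ⟨c', ?_, ?_, ?_, ?_, ?_⟩
  · have hpre : ∀ d : G, MeasurableSet {b : X | d⁻¹ • b ∈ A} := fun d => measurable_const_smul d⁻¹ hA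
    have hm1 : MeasurableSet {b : X | ∃ d ∈ D, d⁻¹ • b ∈ A} := by
      simp only [Set.ofPred_exists, Set.ofPred_and]
      exact MeasurableSet.iUnion fun d => (MeasurableSet.const _).inter (hpre d)
    have hm2 : MeasurableSet {b : X | ∃ d ∈ D, d⁻¹ • b ∈ A ∧ d ∈ v (d⁻¹ • b)} := by
      simp only [Set.ofPred_exists, Set.ofPred_and]
      refine MeasurableSet.iUnion fun d => (MeasurableSet.const _).inter ((hpre d).inter ?_)
      have : {b : X | d ∈ v (d⁻¹ • b)} = ⋃ p ∈ {p : Finset G | d ∈ p}, {b | v (d⁻¹ • b) = p} := by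
        ext b; simp
      rw [this]
      exact MeasurableSet.biUnion (Set.to_countable _)
        fun p _ => measurable_const_smul d⁻¹ (hv p)
    let _ : MeasurableSpace (Option Bool) := ⊤
    have hcm : Measurable c := measurable_to_countable' hc
    have hdm : Measurable fun b : X => decide (∃ d ∈ D, d⁻¹ • b ∈ A ∧ d ∈ v (d⁻¹ • b)) :=
      measurable_to_bool (by convert hm2 using 1; ext; simp)
    have hd2 : Measurable fun b : X => if ∃ d ∈ D, d⁻¹ • b ∈ A then
        some (decide (∃ d ∈ D, d⁻¹ • b ∈ A ∧ d ∈ v (d⁻¹ • b))) else none :=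
      Measurable.ite hm1 ((measurable_of_countable some).comp hdm) measurable_const
    have hc' : Measurable c' := (measurable_of_countable
      (fun q : Option Bool × Option Bool => q.1.or q.2)).comp (hcm.prodMk hd2)
    exact fun o => hc' MeasurableSet.of_discrete
  · intro b α h
    simp [c', h]
  · intro b h hb
    have : ¬ ∃ d ∈ D, d⁻¹ • b ∈ A := by push Not; exact hb
    simp only [c', h, if_neg this, Option.none_or]
  · intro d hd z hz
    have : ∃ d' ∈ D, d'⁻¹ • d • z ∈ A := ⟨d, hd, by simpa using hz⟩
    simp only [c', if_pos this]
    cases c (d • z) <;> simp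
  · intro z hz r hr h hh hcard
    obtain ⟨d, hd, α, h1, h2⟩ := hgood z r hr h hh hcard
    exact ⟨d, hd, α, hfill z hz _ _ h1, hfill z hz _ _ h2⟩

open Classical in
theorem exists_measurable_extension_of_separated {G X : Type*} [Group G] [Countable G]
    [MeasurableSpace X] [StandardBorelSpace X] [MulAction G X] [MeasurableConstSMul G X]
    (hfree : ∀ (g : G) (x : X), g • x = x → g = 1)
    (D H : Finset G) (hD1 : 1 ∈ D) (hDinv : ∀ d ∈ D, d⁻¹ ∈ D) (hH : 1 ∉ H) (m : ℕ)
    (hm : (insert 1 (H⁻¹ * D * D)).card * H.card < 2 ^ m)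
    (U Z : Set X) (hU : MeasurableSet U) (hZ : MeasurableSet Z) (hZU : Z ⊆ U)
    (hsep : ∀ z ∈ Z, ∀ k ∈ D * D * D * D, k • z ∈ Z → k = 1)
    (hbig : ∀ z ∈ Z, 6 * m + 2 ≤ (D.filter fun d => d • z ∈ U).card)
    (c : X → Bool) (hc : Measurable c) :
    ∃ c' : X → Bool, Measurable c' ∧ (∀ b, b ∉ U → c' b = c b) ∧
      ∀ z ∈ Z, ∀ h ∈ H, ∃ d ∈ D, d • z ∉ Z ∧ (d * h) • z ∉ Z ∧ c' (d • z) ≠ c' ((d * h) • z) := by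
  obtain ⟨κ, hκ, hκK⟩ := exists_measurable_coloring_s1 hfree (D * D * H)
  have hinj : ∀ (x : X) {g g' : G}, g • x = g' • x → g = g' := by
    intro x g g' h
    refine (inv_mul_eq_one.1 (hfree (g'⁻¹ * g) x ?_)).symm
    rw [mul_smul, h, inv_smul_smul]
  have hsep4 : ∀ a ∈ D, ∀ b ∈ D, ∀ a' ∈ D, ∀ b' ∈ D, ∀ z ∈ Z, (a * b * a' * b') • z ∈ Z →
      a * b * a' * b' = 1 := fun a ha b hb a' ha' b' hb' z hz h =>
    hsep z hz _ (Finset.mul_mem_mul (Finset.mul_mem_mul (Finset.mul_mem_mul ha hb) ha') hb') h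
  have hsep2 : ∀ d ∈ D, ∀ d' ∈ D, ∀ z ∈ Z, ∀ z' ∈ Z, d • z = d' • z' → z = z' := by
    intro d hd d' hd' z hz z' hz' h
    have h' : (d'⁻¹ * d) • z = z' := by rw [mul_smul, h, inv_smul_smul]
    have := hsep4 d'⁻¹ (hDinv _ hd') d hd 1 hD1 1 hD1 z hz (by simpa [h'] using hz')
    simp only [mul_one] at this
    rw [← h', this, one_smul]
  set D₀ := D.erase 1 with hD₀
  have hD₀D : ∀ {d}, d ∈ D₀ → d ∈ D := fun h => Finset.mem_of_mem_erase h
  have hD₀Z : ∀ d ∈ D₀, ∀ z ∈ Z, d • z ∉ Z := by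
    intro d hd z hz h
    have := hsep4 d (hD₀D hd) 1 hD1 1 hD1 1 hD1 z hz (by simpa using h)
    exact (Finset.mem_erase.1 hd).1 (by simpa using this)
  -- the partial colorings produced by the greedy procedure
  let c₀ : X → Option Bool := fun b =>
    if b ∈ U ∧ ∃ d ∈ D, d⁻¹ • b ∈ Z then none else some (c b)
  have hc₀ : ∀ o, MeasurableSet (c₀ ⁻¹' {o}) := by
    have h1 : MeasurableSet {b : X | b ∈ U ∧ ∃ d ∈ D, d⁻¹ • b ∈ Z} := by
      simp only [Set.ofPred_exists, Set.ofPred_and]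
      exact hU.inter (MeasurableSet.iUnion fun d =>
        (MeasurableSet.const _).inter (measurable_const_smul d⁻¹ hZ))
    let _ : MeasurableSpace (Option Bool) := ⊤
    have : Measurable c₀ :=
      Measurable.ite h1 measurable_const ((measurable_of_countable some).comp hc)
    exact fun o => this MeasurableSet.of_discrete
  have hstep := fun (n : ℕ) (c : {c : X → Option Bool // ∀ o, MeasurableSet (c ⁻¹' {o})}) =>
    exists_measurable_fill D₀ (insert 1 (H⁻¹ * D * D)) H m hm (Z ∩ κ ⁻¹' {n})
      (hZ.inter (hκ (measurableSet_singleton n)))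
      (fun d hd d' hd' z hz z' hz' h => hsep2 d (hD₀D hd) d' (hD₀D hd') z hz.1 z' hz'.1 h)
      hfree c.1 c.2
  choose next hnext_meas hnext_ext hnext_none hnext_some hnext_good using hstep
  let C' : ℕ → {c : X → Option Bool // ∀ o, MeasurableSet (c ⁻¹' {o})} := fun n =>
    Nat.rec ⟨c₀, hc₀⟩ (fun n c => ⟨next n c, hnext_meas n c⟩) n
  let C : ℕ → X → Option Bool := fun n => (C' n).1
  have hCm : ∀ n o, MeasurableSet (C n ⁻¹' {o}) := fun n => (C' n).2
  have hCext : ∀ n b α, C n b = some α → C (n + 1) b = some α := fun n => hnext_ext n (C' n)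
  have hCmono : ∀ n n', n ≤ n' → ∀ b α, C n b = some α → C n' b = some α := by
    intro n n' hn b α h
    induction n', hn using Nat.le_induction with
    | base => exact h
    | succ k _ ih => exact hCext k b α ih
  have hCnone : ∀ n, ∀ d ∈ D, ∀ z ∈ Z, d • z ∈ U → (d = 1 ∨ n ≤ κ z) → C n (d • z) = none := by
    intro n d hd z hz hdU hn
    induction n with
    | zero => exact if_pos ⟨hdU, d, hd, by simpa using hz⟩
    | succ n ih =>
      refine hnext_none n (C' n) _ (ih (hn.imp_right fun h => by omega)) ?_
      rintro d' hd' ⟨h1, h2⟩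
      have h3 := hsep2 d' (hD₀D hd') d hd _ h1 z hz (smul_inv_smul _ _)
      rw [h3] at h2
      rcases hn with rfl | hn
      · refine hD₀Z d' hd' z hz ?_
        have : d' • z = (1 : G) • z := by
          conv_lhs => rw [← h3]
          rw [smul_inv_smul]
        rwa [this, one_smul]
      · have : κ z = n := h2
        omega
  have hCsome : ∀ n, ∀ d ∈ D₀, ∀ z ∈ Z, κ z < n → ∃ α, C n (d • z) = some α := by
    intro n d hd z hz hn
    obtain ⟨α, hα⟩ := Option.ne_none_iff_exists'.1
      (hnext_some (κ z) (C' (κ z)) d hd z ⟨hz, rfl⟩)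
    exact ⟨α, hCmono (κ z + 1) n hn _ _ hα⟩
  have hCunknown : ∀ n b, C n b = none → b ∉ Z →
      b ∈ U ∧ ∃ d ∈ D₀, ∃ z ∈ Z, b = d • z ∧ n ≤ κ z := by
    intro n b hb hbZ
    have h0 : C 0 b = none := by
      cases h : C 0 b with
      | none => rfl
      | some α => rw [hCmono 0 n (Nat.zero_le n) b α h] at hb; exact absurd hb (by simp)
    have h1 : b ∈ U ∧ ∃ d ∈ D, d⁻¹ • b ∈ Z := by
      by_contra hcon
      have : C 0 b = some (c b) := if_neg hcon
      rw [this] at h0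
      exact absurd h0 (by simp)
    obtain ⟨hbU, d, hd, hdZ⟩ := h1
    have hd0 : d ∈ D₀ := Finset.mem_erase.2 ⟨by rintro rfl; exact hbZ (by simpa using hdZ), hd⟩
    refine ⟨hbU, d, hd0, _, hdZ, (smul_inv_smul _ _).symm, ?_⟩
    by_contra! hlt
    obtain ⟨α, hα⟩ := hCsome n d hd0 _ hdZ hlt
    rw [smul_inv_smul, hb] at hα
    exact absurd hα (by simp)
  have hCZ : ∀ n b α, C n b = some α → b ∉ Z := by
    intro n b α h hb
    have := hCnone n 1 hD1 b hb (by simpa using hZU hb) (Or.inl rfl)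
    rw [one_smul, h] at this
    exact absurd this (by simp)
  -- every constraint is met at some stage
  have hkey : ∀ z ∈ Z, ∀ h ∈ H, ∃ n, ∃ d ∈ D₀, ∃ α, C n (d • z) = some α ∧
      C n ((d * h) • z) = some (!α) := by
    intro z hz h hh
    have hh1 : h ≠ 1 := fun e => hH (e ▸ hh)
    let Q := D₀.filter fun d => d • z ∈ U ∧ (d * h) • z ∉ Z
    have hQ : 6 * m ≤ Q.card := by
      have h1 : (D.filter fun d => d • z ∈ U) ⊆
          insert 1 (Q ∪ D.filter fun d => (d * h) • z ∈ Z) := by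
        intro d hd
        obtain ⟨hd, hdU⟩ := Finset.mem_filter.1 hd
        by_cases hd1 : d = 1
        · exact Finset.mem_insert.2 (Or.inl hd1)
        refine Finset.mem_insert_of_mem (Finset.mem_union.2 ?_)
        by_cases hdZ : (d * h) • z ∈ Z
        · exact Or.inr (Finset.mem_filter.2 ⟨hd, hdZ⟩)
        · exact Or.inl (Finset.mem_filter.2 ⟨Finset.mem_erase.2 ⟨hd1, hd⟩, hdU, hdZ⟩)
      have h2 : (D.filter fun d => (d * h) • z ∈ Z).card ≤ 1 := by
        refine Finset.card_le_one.2 fun a ha b hb => ?_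
        obtain ⟨ha, haZ⟩ := Finset.mem_filter.1 ha
        obtain ⟨hb, hbZ⟩ := Finset.mem_filter.1 hb
        have hmul : (b * a⁻¹ * 1 * 1) • (a * h) • z = (b * h) • z := by
          rw [← mul_smul]; congr 1; group
        have := hsep4 b hb a⁻¹ (hDinv a ha) 1 hD1 1 hD1 _ haZ (hmul ▸ hbZ)
        simp only [mul_one] at this
        exact (mul_inv_eq_one.1 this).symm
      have h3 := Finset.card_le_card h1
      have h4 := Finset.card_insert_le 1 (Q ∪ D.filter fun d => (d * h) • z ∈ Z)
      have h5 := Finset.card_union_le Q (D.filter fun d => (d * h) • z ∈ Z)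
      have h6 := hbig z hz
      omega
    obtain ⟨I, hIQ, hI, hIcard⟩ := Q.exists_subset_mul_right_notMem hh1
    have hIspec : ∀ d ∈ I, d ∈ D₀ ∧ d • z ∈ U ∧ (d * h) • z ∉ Z := fun d hd =>
      Finset.mem_filter.1 (hIQ hd)
    let late : G → Prop := fun d => C (κ z) ((d * h) • z) = none ∧ d * h ∉ D₀
    have hsplit := Finset.card_filter_add_card_filter_not (s := I) late
    rcases le_or_gt m (I.filter fun d => ¬ late d).card with hearly | hfew
    · -- the constraint is met when the block of `z` is filled
      refine ⟨κ z + 1, ?_⟩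
      have hg := hnext_good (κ z) (C' (κ z)) z ⟨hz, rfl⟩ 1 (Finset.mem_insert_self _ _) h hh ?_
      · simpa only [mul_one] using hg
      let J := I.filter fun d => ¬ late d
      have hJD : J ⊆ D₀ := fun d hd => (hIspec d (Finset.mem_filter.1 hd).1).1
      refine (Nat.mul_le_mul_left _ (Nat.pow_le_pow_right two_pos hearly)).trans
        (Finset.card_mul_two_pow_le_of_injOn_sdiff hJD (Finset.filter_subset _ _) ?_)
      have hJh : ∀ d ∈ J, d * h ∉ J := fun d hd hd' =>
        hI d (Finset.mem_filter.1 hd).1 (Finset.mem_filter.1 hd').1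
      have hval : ∀ d ∈ J, ∃ f : Finset G → Bool, (∀ p q, p \ J = q \ J → f p = f q) ∧
          ∀ p, fillAt D₀ (C (κ z)) p z (d * h * 1) = some (f p) := by
        intro d hd
        obtain ⟨hdI, hdl⟩ := Finset.mem_filter.1 hd
        cases hv : C (κ z) ((d * h) • z) with
        | some α => exact ⟨fun _ => α, fun _ _ _ => rfl, fun p => by simp [fillAt, hv]⟩
        | none =>
          have hdh : d * h ∈ D₀ := by
            by_contra hcon
            exact hdl ⟨hv, hcon⟩
          refine ⟨fun p => decide (d * h ∈ p), fun p q hpq => ?_, fun p => by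
            simp [fillAt, hv, hdh]⟩
          have := congrArg (d * h ∈ ·) hpq
          simp only [Finset.mem_sdiff, hJh d hd, not_false_eq_true, and_true] at this
          simp only [this]
      have hbad : ∀ p, ¬ Discriminates D₀ (fillAt D₀ (C (κ z)) p z) 1 h → ∀ d ∈ J,
          ∀ β, fillAt D₀ (C (κ z)) p z (d * h * 1) = some β → decide (d ∈ p) = β := by
        intro p hp d hd β hβ
        by_contra hne
        have hdn : C (κ z) (d • z) = none := hCnone _ d (hD₀D (hJD hd)) z hz
          (hIspec d (Finset.mem_filter.1 hd).1).2.1 (Or.inr le_rfl)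
        refine hp ⟨d, hJD hd, decide (d ∈ p), by simp [fillAt, hdn, hJD hd], ?_⟩
        rw [hβ, Bool.eq_not_of_ne (Ne.symm hne)]
      intro p hp q hq hpq
      ext d
      by_cases hd : d ∈ J
      · obtain ⟨f, hf, hfv⟩ := hval d hd
        have h1 := hbad p (Finset.mem_filter.1 hp).2 d hd _ (hfv p)
        have h2 := hbad q (Finset.mem_filter.1 hq).2 d hd _ (hfv q)
        rw [hf p q hpq, ← h2] at h1
        exact decide_eq_decide.1 h1
      · have := congrArg (d ∈ ·) hpq
        simpa [hd] using this
    · -- the constraint is met when the block of a later `z'` is filled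
      have hmany : m ≤ (I.filter late).card := by omega
      have hne : (I.filter late).Nonempty := by
        rw [← Finset.card_pos]
        omega
      obtain ⟨d, hd⟩ := hne
      obtain ⟨hdI, hdn, hdh⟩ := Finset.mem_filter.1 hd
      obtain ⟨hdU, a, ha, z', hz', hdz, hκz⟩ := hCunknown _ _ hdn (hIspec d hdI).2.2
      have hz'z : z' = (a⁻¹ * d * h) • z := by
        rw [mul_assoc, mul_smul, hdz, inv_smul_smul]
      have hne1 : a⁻¹ * d * h ≠ 1 := by
        intro e
        rw [mul_assoc, inv_mul_eq_one] at e
        exact hdh (e ▸ ha)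
      have hlt : κ z < κ z' := by
        refine lt_of_le_of_ne hκz (Ne.symm ?_)
        rw [hz'z]
        exact hκK z _ (Finset.mul_mem_mul (Finset.mul_mem_mul (hDinv a (hD₀D ha))
          (hD₀D (hIspec d hdI).1)) hh) hne1
      have hzz' : (h⁻¹ * d⁻¹ * a) • z' = z := by
        rw [hz'z, ← mul_smul]
        convert one_smul G z
        group
      set r := h⁻¹ * d⁻¹ * a with hr
      have hrR : r ∈ insert 1 (H⁻¹ * D * D) := Finset.mem_insert_of_mem
        (Finset.mul_mem_mul (Finset.mul_mem_mul (Finset.inv_mem_inv hh)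
          (hDinv d (hD₀D (hIspec d hdI).1))) (hD₀D ha))
      refine ⟨κ z' + 1, ?_⟩
      have hg := hnext_good (κ z') (C' (κ z')) z' ⟨hz', rfl⟩ r hrR h hh ?_
      · simpa only [mul_smul _ r, hzz'] using hg
      -- the constraint determines the pattern on the translates seen by late indices
      have hlate : ∀ b ∈ I.filter late, b * h * r ∈ D₀ ∧ C (κ z') ((b * h * r) • z') = none := by
        intro b hb
        obtain ⟨hbI, hbn, -⟩ := Finset.mem_filter.1 hb
        obtain ⟨hbU, a', ha', z'', hz'', hbz, -⟩ := hCunknown _ _ hbn (hIspec b hbI).2.2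
        have hmul : (a'⁻¹ * b * d⁻¹ * a) • z' = z'' := by
          rw [hz'z, ← mul_smul, show a'⁻¹ * b * d⁻¹ * a * (a⁻¹ * d * h) = a'⁻¹ * (b * h) by group,
            mul_smul, hbz, inv_smul_smul]
        have h1 := hsep4 a'⁻¹ (hDinv a' (hD₀D ha')) b (hD₀D (hIspec b hbI).1)
          d⁻¹ (hDinv d (hD₀D (hIspec d hdI).1)) a (hD₀D ha) z' hz' (hmul ▸ hz'')
        have h2 : b * h * r = a' := by
          rw [hr]
          have : a' * (a'⁻¹ * b * d⁻¹ * a) = a' := by rw [h1, mul_one]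
          rw [← this]
          group
        rw [h2]
        refine ⟨ha', hCnone _ a' (hD₀D ha') z' hz' ?_ (Or.inr le_rfl)⟩
        rwa [← h2, mul_smul _ r, hzz']
      let J := (I.filter late).image fun b => b * h * r
      have hJcard : J.card = (I.filter late).card :=
        Finset.card_image_of_injective _ fun x y hxy => by simpa using hxy
      have hJD : J ⊆ D₀ := by
        intro e he
        obtain ⟨b, hb, rfl⟩ := Finset.mem_image.1 he
        exact (hlate b hb).1
      refine (Nat.mul_le_mul_left _ (Nat.pow_le_pow_right two_pos (hJcard ▸ hmany))).trans
        (Finset.card_mul_two_pow_le_of_injOn_sdiff hJD (Finset.filter_subset _ _) ?_)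
      have hbad : ∀ b ∈ I.filter late, ∃ β : Bool, ∀ p,
          ¬ Discriminates D₀ (fillAt D₀ (C (κ z')) p z') r h → decide (b * h * r ∈ p) = β := by
        intro b hb
        have hbI := (Finset.mem_filter.1 hb).1
        obtain ⟨β, hβ⟩ := hCsome (κ z') b (hIspec b hbI).1 z hz hlt
        refine ⟨β, fun p hp => ?_⟩
        by_contra hne
        refine hp ⟨b, (hIspec b hbI).1, β, ?_, ?_⟩
        · simp only [fillAt, mul_smul _ r, hzz', hβ, Option.some_or]
        · simp only [fillAt, hlate b hb, if_true, Option.none_or, Bool.eq_not_of_ne hne]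
      intro p hp q hq hpq
      ext e
      by_cases he : e ∈ J
      · obtain ⟨b, hb, rfl⟩ := Finset.mem_image.1 he
        obtain ⟨β, hβ⟩ := hbad b hb
        exact decide_eq_decide.1 ((hβ p (Finset.mem_filter.1 hp).2).trans
          (hβ q (Finset.mem_filter.1 hq).2).symm)
      · have := congrArg (e ∈ ·) hpq
        simpa [he] using this
  -- the limit coloring
  let c' : X → Bool := fun b => decide (∃ n, C n b = some true)
  have hc' : ∀ n b α, C n b = some α → c' b = α := by
    intro n b α h
    cases α with
    | true => exact decide_eq_true ⟨n, h⟩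
    | false =>
      refine decide_eq_false ?_
      rintro ⟨n', h'⟩
      have h1 := hCmono n (max n n') (le_max_left _ _) b _ h
      rw [hCmono n' (max n n') (le_max_right _ _) b _ h'] at h1
      exact absurd h1 (by simp)
  refine ⟨c', measurable_to_bool ?_, ?_, ?_⟩
  · have : c' ⁻¹' {true} = ⋃ n, C n ⁻¹' {some true} := by
      ext b; simp [c']
    rw [this]
    exact MeasurableSet.iUnion fun n => hCm n _
  · exact fun b hb => hc' 0 b (c b) (if_neg fun h => hb h.1)
  · intro z hz h hh
    obtain ⟨n, d, hd, α, h1, h2⟩ := hkey z hz h hh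
    refine ⟨d, hD₀D hd, hCZ n _ _ h1, hCZ n _ _ h2, ?_⟩
    rw [hc' n _ _ h1, hc' n _ _ h2]
    simp

open Classical in
theorem exists_symmetric_finset_card_filter_ge {G X : Type*} [Group G] [Infinite G]
    [MulAction G X] (F : Finset G) (k : ℕ) :
    ∃ D : Finset G, 1 ∈ D ∧ D⁻¹ = D ∧ D.card ≤ 2 * (F.card * (F.card * k)) + 1 ∧
      ∀ U : Set X, (∀ x, ∃ f ∈ F, f • x ∈ U) → ∀ z, k ≤ (D.filter fun d => d • z ∈ U).card := by
  obtain ⟨E, hE⟩ := Infinite.exists_subset_card_eq G (F.card * k)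
  refine ⟨insert 1 (F * E ∪ (F * E)⁻¹), Finset.mem_insert_self _ _, ?_, ?_, ?_⟩
  · generalize F * E = A
    ext x
    simp [Finset.mem_inv', or_comm]
  · have h1 := Finset.card_insert_le 1 (F * E ∪ (F * E)⁻¹)
    have h2 := Finset.card_union_le (F * E) (F * E)⁻¹
    have h3 : (F * E).card ≤ F.card * (F.card * k) := hE ▸ Finset.card_mul_le
    rw [Finset.card_inv] at h2
    omega
  · intro U hU z
    choose φ hφF hφU using hU
    have hF : 0 < F.card := Finset.card_pos.2 ⟨_, hφF z⟩
    refine Nat.le_of_mul_le_mul_left ?_ hF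
    rw [← hE]
    refine Finset.card_le_mul_card_image_of_maps_to (f := fun e => φ (e • z) * e) ?_ _ ?_
    · intro e he
      refine Finset.mem_filter.2 ⟨Finset.mem_insert_of_mem (Finset.mem_union_left _
        (Finset.mul_mem_mul (hφF _) he)), ?_⟩
      rw [mul_smul]
      exact hφU _
    · intro b _
      refine (Finset.card_le_card (t := F.image fun f => f⁻¹ * b) ?_).trans Finset.card_image_le
      intro e he
      obtain ⟨-, rfl⟩ := Finset.mem_filter.1 he
      exact Finset.mem_image.2 ⟨_, hφF (e • z), by group⟩

open Classical in
theorem exists_measurable_extension_moving {G X : Type*} [Group G] [Countable G] [Infinite G]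
    [MeasurableSpace X] [StandardBorelSpace X] [MulAction G X] [MeasurableConstSMul G X]
    (hfree : ∀ (g : G) (x : X), g • x = x → g = 1) {g : G} (hg : g ≠ 1)
    (U : Set X) (hU : MeasurableSet U) (F : Finset G) (hF : ∀ x, ∃ f ∈ F, f • x ∈ U)
    (c : X → Bool) (hc : Measurable c) :
    ∃ Z ⊆ U, MeasurableSet Z ∧ (∃ S : Finset G, ∀ x, ∃ s ∈ S, s • x ∈ Z) ∧
      ∃ c' : X → Bool, Measurable c' ∧ (∀ b, b ∉ U → c' b = c b) ∧
        ∃ T : Finset G, ∀ x, ∃ t ∈ T, t • x ∉ Z ∧ t • g • x ∉ Z ∧ c' (t • x) ≠ c' (t • g • x) := by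
  set n := F.card with hn
  obtain ⟨m, hm⟩ := exists_mul_pow_lt_two_pow ((1 + n) * n * (12 * n ^ 2 + 1) ^ 10) 10
  obtain ⟨D, hD1, hDinv, hDcard, hDU⟩ :=
    exists_symmetric_finset_card_filter_ge (X := X) F (6 * m + 2)
  set K := D * D * D * D with hK
  have hK1 : (1 : G) ∈ K := by
    simpa using Finset.mul_mem_mul (Finset.mul_mem_mul (Finset.mul_mem_mul hD1 hD1) hD1) hD1
  have hKinv : K⁻¹ = K := by
    simp only [hK, mul_inv_rev, hDinv, mul_assoc]
  obtain ⟨Z, hZU, hZ, hsep, hmax⟩ := exists_measurable_maximal_separated hfree K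
    (fun k hk => Finset.mem_inv'.1 (hKinv.symm ▸ hk)) U hU
  have hSZ : ∀ x, ∃ s ∈ K * F, s • x ∈ Z := by
    intro x
    obtain ⟨f, hf, hfx⟩ := hF x
    rcases hmax _ hfx with h | ⟨k, hk, hkx⟩
    · exact ⟨1 * f, Finset.mul_mem_mul hK1 hf, by simpa using h⟩
    · exact ⟨k * f, Finset.mul_mem_mul hk hf, by rwa [mul_smul]⟩
  set H := (K * F).image fun s => s * g * s⁻¹ with hH
  have hH1 : 1 ∉ H := by
    intro h
    obtain ⟨s, -, hs⟩ := Finset.mem_image.1 h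
    exact hg (conj_eq_one_iff.1 hs)
  have hcard : (insert 1 (H⁻¹ * D * D)).card * H.card < 2 ^ m := by
    refine lt_of_le_of_lt ?_ hm
    have hDpos : 1 ≤ D.card := Finset.card_pos.2 ⟨1, hD1⟩
    have h1 : K.card ≤ D.card ^ 4 := by
      refine Finset.card_mul_le.trans ((Nat.mul_le_mul_right _ (Finset.card_mul_le.trans
        (Nat.mul_le_mul_right _ Finset.card_mul_le))).trans (le_of_eq (by ring)))
    have h2 : H.card ≤ D.card ^ 4 * n :=
      Finset.card_image_le.trans (Finset.card_mul_le.trans (Nat.mul_le_mul_right _ h1))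
    have h3 : (insert 1 (H⁻¹ * D * D)).card ≤ D.card ^ 6 * (1 + n) := by
      have h4 := Finset.card_insert_le 1 (H⁻¹ * D * D)
      have h5 : (H⁻¹ * D * D).card ≤ (D.card ^ 4 * n) * D.card * D.card := by
        refine Finset.card_mul_le.trans (Nat.mul_le_mul_right _ (Finset.card_mul_le.trans
          (Nat.mul_le_mul_right _ ?_)))
        rwa [Finset.card_inv]
      have h6 : 1 ≤ D.card ^ 6 := Nat.one_le_pow _ _ hDpos
      calc (insert 1 (H⁻¹ * D * D)).card ≤ (D.card ^ 4 * n) * D.card * D.card + 1 := by omega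
        _ = D.card ^ 6 * n + 1 := by ring
        _ ≤ D.card ^ 6 * (1 + n) := by linarith
    have h7 : D.card ≤ (12 * n ^ 2 + 1) * (m + 1) := by nlinarith
    calc (insert 1 (H⁻¹ * D * D)).card * H.card
        ≤ (D.card ^ 6 * (1 + n)) * (D.card ^ 4 * n) := Nat.mul_le_mul h3 h2
      _ = (1 + n) * n * D.card ^ 10 := by ring
      _ ≤ (1 + n) * n * ((12 * n ^ 2 + 1) * (m + 1)) ^ 10 :=
        Nat.mul_le_mul_left _ (Nat.pow_le_pow_left h7 10)
      _ = (1 + n) * n * (12 * n ^ 2 + 1) ^ 10 * (m + 1) ^ 10 := by ring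
  obtain ⟨c', hc', hext, hsplit⟩ := exists_measurable_extension_of_separated hfree D H hD1
    (fun d hd => Finset.mem_inv'.1 (hDinv.symm ▸ hd)) hH1 m hcard U Z hU hZ hZU hsep
    (fun z _ => hDU U hF z) c hc
  refine ⟨Z, hZU, hZ, ⟨K * F, hSZ⟩, c', hc', hext, D * (K * F), fun x => ?_⟩
  obtain ⟨s, hs, hsx⟩ := hSZ x
  obtain ⟨d, hd, h1, h2, h3⟩ := hsplit _ hsx _ (Finset.mem_image_of_mem _ hs)
  have hmul : (d * (s * g * s⁻¹)) • s • x = (d * s) • g • x := by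
    simp only [← mul_smul]
    congr 1
    group
  rw [← mul_smul] at h1 h3
  rw [hmul] at h2 h3
  exact ⟨d * s, Finset.mul_mem_mul hd hs, h1, h2, h3⟩

theorem exists_measurable_extension_moving_all {G X : Type*} [Group G] [Countable G] [Infinite G]
    [MeasurableSpace X] [StandardBorelSpace X] [MulAction G X] [MeasurableConstSMul G X]
    (hfree : ∀ (g : G) (x : X), g • x = x → g = 1)
    (U : Set X) (hU : MeasurableSet U) (hF : ∃ F : Finset G, ∀ x, ∃ f ∈ F, f • x ∈ U)
    (c : X → Bool) (hc : Measurable c) :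
    ∃ c' : X → Bool, Measurable c' ∧ (∀ b, b ∉ U → c' b = c b) ∧
      ∀ g : G, g ≠ 1 → ∃ T : Finset G, ∀ x, ∃ t ∈ T, c' (t • x) ≠ c' (t • g • x) := by
  classical
  obtain ⟨u, hu⟩ := exists_surjective_nat G
  let State := {s : Set X × (X → Bool) // MeasurableSet s.1 ∧ Measurable s.2 ∧
    ∃ F : Finset G, ∀ x, ∃ f ∈ F, f • x ∈ s.1}
  have hstep : ∀ (n : ℕ) (s : State), ∃ s' : State, s'.1.1 ⊆ s.1.1 ∧
      (∀ b, b ∉ s.1.1 → s'.1.2 b = s.1.2 b) ∧ (u n ≠ 1 → ∃ T : Finset G, ∀ x, ∃ t ∈ T,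
        t • x ∉ s'.1.1 ∧ t • u n • x ∉ s'.1.1 ∧ s'.1.2 (t • x) ≠ s'.1.2 (t • u n • x)) := by
    rintro n ⟨⟨V, a⟩, hV, ha, F, hF⟩
    by_cases hn : u n = 1
    · exact ⟨⟨⟨V, a⟩, hV, ha, F, hF⟩, le_rfl, fun _ _ => rfl, fun h => absurd hn h⟩
    · obtain ⟨Z, hZV, hZ, hS, a', ha', hext, hT⟩ :=
        exists_measurable_extension_moving hfree hn V hV F hF a ha
      exact ⟨⟨⟨Z, a'⟩, hZ, ha', hS⟩, hZV, hext, fun _ => hT⟩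
  choose next hnext_sub hnext_ext hnext_T using hstep
  let s : ℕ → State := fun n => Nat.rec ⟨⟨U, c⟩, hU, hc, hF⟩ next n
  have hsub : ∀ n n', n ≤ n' → (s n').1.1 ⊆ (s n).1.1 := fun n n' h =>
    antitone_nat_of_succ_le (f := fun n => (s n).1.1) (fun n => hnext_sub n (s n)) h
  have hext : ∀ n n', n ≤ n' → ∀ b, b ∉ (s n).1.1 → (s n').1.2 b = (s n).1.2 b := by
    intro n n' h b hb
    induction n', h using Nat.le_induction with
    | base => rfl
    | succ k hk ih => exact (hnext_ext k (s k) b fun h => hb (hsub n k hk h)).trans ih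
  let c' : X → Bool := fun b => decide (∃ n, b ∉ (s n).1.1 ∧ (s n).1.2 b = true)
  have hc' : ∀ n b, b ∉ (s n).1.1 → c' b = (s n).1.2 b := by
    intro n b hb
    refine Bool.eq_iff_iff.2 ?_
    simp only [c', decide_eq_true_eq]
    refine ⟨?_, fun h => ⟨n, hb, h⟩⟩
    rintro ⟨n', hb', h'⟩
    rcases le_total n n' with h | h
    · rw [← h', hext n n' h b hb]
    · rw [← h', hext n' n h b hb']
  refine ⟨c', measurable_to_bool ?_, fun b hb => hc' 0 b hb, fun g hg => ?_⟩
  · have : c' ⁻¹' {true} = ⋃ n, (s n).1.1ᶜ ∩ (s n).1.2 ⁻¹' {true} := by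
      ext b; simp [c']
    rw [this]
    exact MeasurableSet.iUnion fun n =>
      (s n).2.1.compl.inter ((s n).2.2.1 (measurableSet_singleton _))
  · obtain ⟨n, rfl⟩ := hu g
    obtain ⟨T, hT⟩ := hnext_T n (s n) hg
    refine ⟨T, fun x => ?_⟩
    obtain ⟨t, ht, h1, h2, h3⟩ := hT x
    exact ⟨t, ht, by rwa [hc' (n + 1) _ h1, hc' (n + 1) _ h2]⟩

end GreedyColoring

/-- Theorem 1.1.(1): given a Borel set `Y ⊆ X` with syndetic complement and a Borel function
`φ : Y → 2`, there is a `G`-equivariant Borel map `f : X → 2^G` with `closure (f '' X)` inside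
the free part and with `f y (1) = φ y` for all `y ∈ Y`. -/
theorem equivariant_map_into_free_part_extending
    {G : Type*} [Group G] [Countable G] [Infinite G]
    {X : Type*} [MeasurableSpace X] [StandardBorelSpace X] [MulAction G X]
    (hBorel : ∀ g : G, Measurable fun x : X => g • x)
    (hfree : ∀ (g : G) (x : X), g • x = x → g = 1)
    (Y : Set X) (hY : MeasurableSet Y) (hYc : Syndetic (G := G) Yᶜ)
    (φ : Y → Bool) (hφ : Measurable φ) :
    ∃ f : X → (G → Bool),
      Measurable f ∧
      (∀ (g : G) (x : X), f (g • x) = shift g (f x)) ∧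
      closure (Set.range f) ⊆ FreePart G ∧
      ∀ y : Y, f (y : X) 1 = φ y := by
  classical
  have : MeasurableConstSMul G X := ⟨hBorel⟩
  obtain ⟨F, hF⟩ := hYc
  obtain ⟨c, hc, hcφ⟩ := (MeasurableEmbedding.subtype_coe hY).exists_measurable_extend hφ
    fun _ => ⟨false⟩
  obtain ⟨c', hc', hext, hmove⟩ := exists_measurable_extension_moving_all hfree Yᶜ hY.compl
    ⟨F.image (·⁻¹), fun x => by
      obtain ⟨g, hg, hgx⟩ := hF x
      exact ⟨g⁻¹, Finset.mem_image_of_mem _ hg, hgx⟩⟩ c hc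
  refine ⟨fun x h => c' (h⁻¹ • x), measurable_pi_lambda _ fun h => hc'.comp (hBorel h⁻¹), ?_, ?_, ?_⟩
  · intro g x
    ext h
    simp [shift, mul_smul]
  · intro w hw g hg hgw
    obtain ⟨T, hT⟩ := hmove g hg
    have hclosed : IsClosed {w : G → Bool | ∃ t ∈ T, w t⁻¹ ≠ w (g⁻¹ * t⁻¹)} := by
      have : {w : G → Bool | ∃ t ∈ T, w t⁻¹ ≠ w (g⁻¹ * t⁻¹)}
          = ⋃ t ∈ T, {w | w t⁻¹ ≠ w (g⁻¹ * t⁻¹)} := by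
        ext; simp
      rw [this]
      refine T.finite_toSet.isClosed_biUnion fun t _ => ?_
      have hcont : Continuous fun w : G → Bool => (w t⁻¹, w (g⁻¹ * t⁻¹)) := by fun_prop
      exact IsClosed.preimage hcont (isClosed_discrete {q : Bool × Bool | q.1 ≠ q.2})
    have hsub : Set.range (fun (x : X) (h : G) => c' (h⁻¹ • x))
        ⊆ {w : G → Bool | ∃ t ∈ T, w t⁻¹ ≠ w (g⁻¹ * t⁻¹)} := by
      rintro _ ⟨x, rfl⟩
      obtain ⟨t, ht, hne⟩ := hT x
      exact ⟨t, ht, by simpa [mul_smul] using hne⟩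
    obtain ⟨t, -, hne⟩ := closure_minimal hsub hclosed hw
    exact hne (congrFun hgw t⁻¹).symm
  · intro y
    have := congrFun hcφ y
    simp only [Function.comp] at this
    simpa [this] using hext y (fun h => h y.2)
end
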